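/- Let K ≥ 1 be a fixed integer. For the random walk on the spider SP(K), almost surely limsup_{n→∞} ( min_{1 ≤ j ≤ K} M_K(n,j) ) / √(2 n log log n) = 1/(2K − 1), where M_K(n,j) is the maximal height reached on leg j in the first n steps. -/

import Mathlib

open MeasureTheory Filter

/-- The vertex set of the spider `SP(N)`: the body, and points on the legs.
`leg r j` denotes the vertex of height `r + 1` on leg `j`. -/
inductive SpiderV (N : ℕ) where
  | body : SpiderV N
  | leg : ℕ → Fin N → SpiderV N
deriving DecidableEq

instance (N : ℕ) : MeasurableSpace (SpiderV N) := ⊤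

/-- The one-step transition probabilities of the random walk on the spider `SP(N)`:
from the body it moves to height `1` of each leg with probability `1/N`; from a vertex
of height `r ≥ 1` on a leg it moves up or down that leg with probability `1/2` each
(height `0` being the body). -/
noncomputable def spiderKernel (N : ℕ) : SpiderV N → SpiderV N → ENNReal
  | .body, .leg 0 _ => 1 / N
  | .leg 0 _, .body => 1 / 2
  | .leg r j, .leg r' j' => if j = j' ∧ (r' = r + 1 ∨ r = r' + 1) then 1 / 2 else 0
  | _, _ => 0

/-- The height of the walker on leg `j`: `0` if the walker is at the body or on another
leg, and `r + 1` at the vertex `leg r j`. -/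
def heightOnLeg {N : ℕ} (j : Fin N) : SpiderV N → ℕ
  | .body => 0
  | .leg r j' => if j' = j then r + 1 else 0

open scoped ENNReal

namespace SpiderProof

instance instCountableSpider (K : ℕ) : Countable (SpiderV K) := by
  have : Function.Injective (fun v : SpiderV K => match v with
    | .body => (none : Option (ℕ × Fin K))
    | .leg r j => some (r, j)) := by
    intro a b h
    cases a <;> cases b <;> simp_all
  exact this.countable

instance instDiscSpider (K : ℕ) : DiscreteMeasurableSpace (SpiderV K) := ⟨fun _ => trivial⟩

instance instMeasListSpider (K : ℕ) : MeasurableSpace (List (SpiderV K)) := ⊤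

instance instDiscListSpider (K : ℕ) : DiscreteMeasurableSpace (List (SpiderV K)) :=
  ⟨fun _ => trivial⟩

/-- The vertex at height `r` on leg `j` (the body for `r = 0`). -/
def atH {K : ℕ} : ℕ → Fin K → SpiderV K
  | 0, _ => .body
  | r + 1, j => .leg r j

/-- Height of a vertex. -/
def ht {K : ℕ} : SpiderV K → ℕ
  | .body => 0
  | .leg r _ => r + 1

/-- Real transition operator. -/
noncomputable def opP {K : ℕ} (φ : SpiderV K → ℝ) : SpiderV K → ℝ
  | .body => (1 / K) * ∑ j, φ (.leg 0 j)
  | .leg r j => (φ (atH r j) + φ (.leg (r + 1) j)) / 2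

/-- The list of the vertices visited before time `n`, the latest first. -/
def past {K : ℕ} {Ω : Type} (W : ℕ → Ω → SpiderV K) : ℕ → Ω → List (SpiderV K)
  | 0, _ => []
  | n + 1, ω => W n ω :: past W n ω

lemma mem_past {K : ℕ} {Ω : Type} (W : ℕ → Ω → SpiderV K) (n : ℕ) (ω : Ω) (v : SpiderV K) :
    v ∈ past W n ω ↔ ∃ t < n, v = W t ω := by
  induction n with
  | zero => simp [past]
  | succ n ih =>
    simp only [past, List.mem_cons, ih]
    constructor
    · rintro (h | ⟨t, ht, h⟩)
      · exact ⟨n, by omega, h⟩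
      · exact ⟨t, by omega, h⟩
    · rintro ⟨t, ht, h⟩
      rcases Nat.lt_succ_iff_lt_or_eq.mp ht with h' | h'
      · exact Or.inr ⟨t, h', h⟩
      · subst h'; exact Or.inl h

lemma past_eq_iff {K : ℕ} {Ω : Type} (W : ℕ → Ω → SpiderV K) (n : ℕ) (ω ω' : Ω) :
    past W n ω = past W n ω' ↔ ∀ k < n, W k ω = W k ω' := by
  induction n with
  | zero => simp [past]
  | succ n ih =>
    simp only [past, List.cons.injEq, ih]
    constructor
    · rintro ⟨h1, h2⟩ k hk
      rcases Nat.lt_succ_iff_lt_or_eq.mp hk with h' | h'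
      · exact h2 k h'
      · subst h'; exact h1
    · intro h
      exact ⟨h n (by omega), fun k hk => h k (by omega)⟩

lemma measurable_past {K : ℕ} {Ω : Type} [MeasurableSpace Ω] (W : ℕ → Ω → SpiderV K)
    (hmeas : ∀ n, Measurable (W n)) (n : ℕ) : Measurable (past W n) := by
  induction n with
  | zero => exact measurable_const
  | succ n ih =>
    have h : Measurable (fun p : SpiderV K × List (SpiderV K) => p.1 :: p.2) :=
      Measurable.of_discrete
    exact h.comp ((hmeas n).prodMk ih)

lemma kernel_sum {K : ℕ} (φ : SpiderV K → ℝ) (hφ : ∀ v, 0 ≤ φ v) (v : SpiderV K) :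
    ∑' w, spiderKernel K v w * ENNReal.ofReal (φ w) = ENNReal.ofReal (opP φ v) := by
  classical
  cases v with
  | body =>
    rw [tsum_eq_sum (s := Finset.univ.image (fun j : Fin K => SpiderV.leg 0 j))]
    · rw [Finset.sum_image (by intro a _ b _ h; simpa using h)]
      simp only [opP, spiderKernel]
      rw [← Finset.mul_sum, ENNReal.ofReal_mul (by positivity),
        ENNReal.ofReal_sum_of_nonneg (fun _ _ => hφ _)]
      rcases Nat.eq_zero_or_pos K with h | h
      · subst h; simp
      · congr 1
        rw [one_div, one_div, ENNReal.ofReal_inv_of_pos (by exact_mod_cast h)]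
        simp
    · intro w hw
      rcases w with _ | ⟨r, j⟩
      · simp [spiderKernel]
      · rcases r with _ | r
        · simp at hw
        · simp [spiderKernel]
  | leg r j =>
    have hne : atH r j ≠ SpiderV.leg (r + 1) j := by
      cases r with
      | zero => simp [atH]
      | succ r => simp only [atH, ne_eq, SpiderV.leg.injEq, not_and]; omega
    rw [tsum_eq_sum (s := {atH r j, SpiderV.leg (r + 1) j})]
    · rw [Finset.sum_pair hne]
      have h1 : spiderKernel K (.leg r j) (atH r j) = 1 / 2 := by
        cases r <;> simp [atH, spiderKernel]
      have h2 : spiderKernel K (.leg r j) (.leg (r + 1) j) = 1 / 2 := by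
        cases r <;> simp [spiderKernel]
      rw [h1, h2, ← mul_add, ← ENNReal.ofReal_add (hφ _) (hφ _)]
      simp only [opP]
      rw [div_eq_inv_mul, ENNReal.ofReal_mul (by norm_num),
        ENNReal.ofReal_inv_of_pos (by norm_num)]
      simp
    · intro w hw
      have h0 : spiderKernel K (.leg r j) w = 0 := by
        rcases w with _ | ⟨r', j'⟩
        · cases r <;> simp_all [atH, spiderKernel]
        · have : ¬ (j = j' ∧ (r' = r + 1 ∨ r = r' + 1)) := by
            rintro ⟨rfl, rfl | rfl⟩
            · simp at hw
            · simp [atH] at hw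
          cases r <;> cases r' <;> simp_all [spiderKernel]
      rw [h0, zero_mul]

section
variable {K : ℕ} {Ω : Type} [MeasurableSpace Ω] {P : Measure Ω}
    {W : ℕ → Ω → SpiderV K}

lemma markov_list
    (hMarkov : ∀ n (h : ℕ → SpiderV K) (w : SpiderV K),
      P ({ω | W (n + 1) ω = w} ∩ {ω | ∀ k ≤ n, W k ω = h k})
        = spiderKernel K (h n) w * P {ω | ∀ k ≤ n, W k ω = h k})
    (n : ℕ) (v w : SpiderV K) (l : List (SpiderV K)) :
    P {ω | past W (n + 2) ω = w :: v :: l}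
      = spiderKernel K v w * P {ω | past W (n + 1) ω = v :: l} := by
  by_cases hex : ∃ ω, past W (n + 1) ω = v :: l
  · obtain ⟨ω0, h0⟩ := hex
    have hv : W n ω0 = v := by simp only [past, List.cons.injEq] at h0; exact h0.1
    have h := hMarkov n (fun k => W k ω0) w
    have e1 : {ω | past W (n + 1) ω = v :: l} = {ω | ∀ k ≤ n, W k ω = W k ω0} := by
      ext ω
      simp only [Set.mem_ofPred_eq]
      rw [← h0, past_eq_iff]
      simp only [Nat.lt_succ_iff]
    have e2 : {ω | past W (n + 2) ω = w :: v :: l}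
        = {ω | W (n + 1) ω = w} ∩ {ω | ∀ k ≤ n, W k ω = W k ω0} := by
      rw [← e1]
      ext ω
      simp only [past, List.cons.injEq, Set.mem_ofPred_eq, Set.mem_inter_iff]
    rw [e1, e2, h, hv]
  · have e1 : {ω | past W (n + 1) ω = v :: l} = ∅ := by
      ext ω; simp only [Set.mem_ofPred_eq, Set.mem_empty_iff_false, iff_false]
      exact fun h => hex ⟨ω, h⟩
    have e2 : {ω | past W (n + 2) ω = w :: v :: l} = ∅ := by
      ext ω; simp only [Set.mem_ofPred_eq, Set.mem_empty_iff_false, iff_false]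
      intro h
      rw [past] at h
      exact hex ⟨ω, (List.cons.inj h).2⟩
    rw [e1, e2]; simp

lemma markov_lintegral (hmeas : ∀ n, Measurable (W n))
    (hMarkov : ∀ n (h : ℕ → SpiderV K) (w : SpiderV K),
      P ({ω | W (n + 1) ω = w} ∩ {ω | ∀ k ≤ n, W k ω = h k})
        = spiderKernel K (h n) w * P {ω | ∀ k ≤ n, W k ω = h k})
    (n : ℕ) (F : List (SpiderV K) → ℝ≥0∞) :
    ∫⁻ ω, F (past W (n + 2) ω) ∂P
      = ∫⁻ ω, ∑' w, spiderKernel K (W n ω) w * F (w :: past W (n + 1) ω) ∂P := by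
  have hm1 := measurable_past W hmeas (n + 1)
  have hm2 := measurable_past W hmeas (n + 2)
  -- right-hand side as a function of the history
  let G : List (SpiderV K) → ℝ≥0∞ := fun l =>
    match l with
    | [] => 0
    | v :: l => ∑' w, spiderKernel K v w * F (w :: v :: l)
  have hG : ∀ ω, ∑' w, spiderKernel K (W n ω) w * F (w :: past W (n + 1) ω)
      = G (past W (n + 1) ω) := fun ω => rfl
  simp_rw [hG]
  -- left-hand side through the pair
  have hpair : Measurable (fun ω => (W (n + 1) ω, past W (n + 1) ω)) :=
    (hmeas (n + 1)).prodMk hm1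
  have hL : ∫⁻ ω, F (past W (n + 2) ω) ∂P
      = ∫⁻ p, F (p.1 :: p.2) ∂(P.map (fun ω => (W (n + 1) ω, past W (n + 1) ω))) := by
    rw [lintegral_map Measurable.of_discrete hpair]
    rfl
  have hR : ∫⁻ ω, G (past W (n + 1) ω) ∂P = ∫⁻ l, G l ∂(P.map (past W (n + 1))) := by
    rw [lintegral_map Measurable.of_discrete hm1]
  rw [hL, hR, lintegral_countable', lintegral_countable',
    ENNReal.tsum_prod (f := fun w l => F (w :: l) *
      (P.map (fun ω => (W (n + 1) ω, past W (n + 1) ω))) {(w, l)}), ENNReal.tsum_comm]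
  refine tsum_congr fun l => ?_
  rw [Measure.map_apply hm1 (MeasurableSet.singleton _)]
  have hs : ∀ w, (P.map (fun ω => (W (n + 1) ω, past W (n + 1) ω))) {(w, l)}
      = P {ω | past W (n + 2) ω = w :: l} := by
    intro w
    rw [Measure.map_apply hpair (MeasurableSet.singleton _)]
    congr 1
    ext ω
    simp [past]
  simp_rw [hs]
  rcases l with _ | ⟨v, l⟩
  · have : ∀ w, P {ω | past W (n + 2) ω = [w]} = 0 := by
      intro w
      have : {ω | past W (n + 2) ω = [w]} = ∅ := by
        ext ω; simp [past]
      rw [this]; simp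
    simp [this, G]
  · simp_rw [markov_list hMarkov n v _ l]
    simp only [G]
    rw [← ENNReal.tsum_mul_right]
    refine tsum_congr fun w => ?_
    have : past W (n + 1) ⁻¹' {v :: l} = {ω | past W (n + 1) ω = v :: l} := rfl
    rw [this]; ring

lemma iter_lower (hmeas : ∀ n, Measurable (W n))
    (hMarkov : ∀ n (h : ℕ → SpiderV K) (w : SpiderV K),
      P ({ω | W (n + 1) ω = w} ∩ {ω | ∀ k ≤ n, W k ω = h k})
        = spiderKernel K (h n) w * P {ω | ∀ k ≤ n, W k ω = h k})
    (F : ℕ → List (SpiderV K) → ℝ≥0∞)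
    (hF : ∀ s v l, F (s + 1) (v :: l) ≤ ∑' w, spiderKernel K v w * F s (w :: v :: l))
    (N n : ℕ) (S : Set (List (SpiderV K))) :
    ∫⁻ ω in past W (n + 1) ⁻¹' S, F N (past W (n + 1) ω) ∂P
      ≤ ∫⁻ ω in past W (n + 1) ⁻¹' S, F 0 (past W (n + N + 1) ω) ∂P := by
  induction N generalizing n S with
  | zero => exact le_rfl
  | succ N ih =>
    have hS : past W (n + 1) ⁻¹' S = past W (n + 2) ⁻¹' (List.tail ⁻¹' S) := by
      ext ω; simp [past]
    have h1 := ih (n + 1) (List.tail ⁻¹' S)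
    rw [← hS] at h1
    have e : n + (N + 1) + 1 = n + 1 + N + 1 := by ring
    rw [e]
    refine le_trans ?_ h1
    have hms : MeasurableSet (past W (n + 1) ⁻¹' S) :=
      measurable_past W hmeas (n + 1) (MeasurableSet.of_discrete)
    rw [← lintegral_indicator hms, ← lintegral_indicator hms]
    have h2 := markov_lintegral hmeas hMarkov n (fun l => (List.tail ⁻¹' S).indicator (F N) l)
    have e3 : ∀ ω, (past W (n + 1) ⁻¹' S).indicator (fun ω => F N (past W (n + 1 + 1) ω)) ω
        = (List.tail ⁻¹' S).indicator (F N) (past W (n + 2) ω) := by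
      intro ω
      by_cases h : past W (n + 1) ω ∈ S
      · have h' : past W (n + 2) ω ∈ List.tail ⁻¹' S := by simpa [past] using h
        rw [Set.indicator_of_mem h', Set.indicator_of_mem (by exact h)]
      · have h' : past W (n + 2) ω ∉ List.tail ⁻¹' S := by simpa [past] using h
        rw [Set.indicator_of_notMem h', Set.indicator_of_notMem (by exact h)]
    simp_rw [e3]
    rw [h2]
    refine lintegral_mono fun ω => ?_
    by_cases h : past W (n + 1) ω ∈ S
    · rw [Set.indicator_of_mem (by exact h)]
      refine (hF N _ _).trans (ENNReal.tsum_le_tsum fun w => ?_)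
      rw [Set.indicator_of_mem (by exact h)]
      rfl
    · rw [Set.indicator_of_notMem (by exact h)]
      exact zero_le

lemma iter_upper (hmeas : ∀ n, Measurable (W n))
    (hMarkov : ∀ n (h : ℕ → SpiderV K) (w : SpiderV K),
      P ({ω | W (n + 1) ω = w} ∩ {ω | ∀ k ≤ n, W k ω = h k})
        = spiderKernel K (h n) w * P {ω | ∀ k ≤ n, W k ω = h k})
    (F : ℕ → List (SpiderV K) → ℝ≥0∞)
    (hF : ∀ s v l, ∑' w, spiderKernel K v w * F s (w :: v :: l) ≤ F (s + 1) (v :: l))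
    (N n : ℕ) :
    ∫⁻ ω, F 0 (past W (n + N + 1) ω) ∂P ≤ ∫⁻ ω, F N (past W (n + 1) ω) ∂P := by
  induction N generalizing n with
  | zero => exact le_rfl
  | succ N ih =>
    have h1 := ih (n + 1)
    have e : n + (N + 1) + 1 = n + 1 + N + 1 := by ring
    rw [e]
    refine h1.trans ?_
    rw [markov_lintegral hmeas hMarkov n]
    exact lintegral_mono fun ω => hF N _ _

end

section potential
variable {K : ℕ}

/-- Legs on which height `x` has been reached by the vertices of the list. -/
def legsHit (x : ℕ) (l : List (SpiderV K)) : Finset (Fin K) :=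
  Finset.univ.filter (fun j => ∃ v ∈ l, x ≤ heightOnLeg j v)

/-- Legs on which `v` has height at least `x`. -/
def newLegs (x : ℕ) (v : SpiderV K) : Finset (Fin K) :=
  Finset.univ.filter (fun j => x ≤ heightOnLeg j v)

lemma legsHit_cons (x : ℕ) (w : SpiderV K) (l : List (SpiderV K)) :
    legsHit x (w :: l) = legsHit x l ∪ newLegs x w := by
  ext j
  simp [legsHit, newLegs, or_comm]

lemma opP_mono {φ ψ : SpiderV K → ℝ} (v : SpiderV K)
    (h : ∀ w, (∀ j, heightOnLeg j w ≤ heightOnLeg j v + 1) → φ w ≤ ψ w) :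
    opP φ v ≤ opP ψ v := by
  cases v with
  | body =>
    simp only [opP]
    refine mul_le_mul_of_nonneg_left (Finset.sum_le_sum fun j _ => h _ ?_) (by positivity)
    intro j'
    simp only [heightOnLeg]; split_ifs <;> omega
  | leg r j =>
    simp only [opP]
    have h1 := h (atH r j) (by
      intro j'
      cases r <;> simp only [heightOnLeg, atH] <;> split_ifs <;> omega)
    have h2 := h (.leg (r + 1) j) (by
      intro j'
      simp only [heightOnLeg]; split_ifs <;> omega)
    linarith

/-- The formula for the potential, on leg `j` at height `r`. -/
noncomputable def potLeg (c : ℕ → ℝ) (g : ℝ → ℝ) (x : ℕ) (A : Finset (Fin K)) (j : Fin K)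
    (r : ℝ) : ℝ :=
  c (K - A.card) * (g ((2 * ((K - A.card : ℕ) : ℝ) - 1) * x + r) +
    if j ∈ A then 0 else
      K / (2 * ((K - A.card : ℕ) : ℝ)) *
        (g ((2 * ((K - A.card : ℕ) : ℝ) - 1) * x - r) -
          g ((2 * ((K - A.card : ℕ) : ℝ) - 1) * x + r)))

/-- The potential, before the terminal condition. -/
noncomputable def potLin (c : ℕ → ℝ) (g : ℝ → ℝ) (x : ℕ) (A : Finset (Fin K)) :
    SpiderV K → ℝ
  | .body => c (K - A.card) * g ((2 * ((K - A.card : ℕ) : ℝ) - 1) * x)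
  | .leg r j => potLeg c g x A j ((r : ℝ) + 1)

open Classical in
/-- The potential. -/
noncomputable def pot (c : ℕ → ℝ) (g : ℝ → ℝ) (x : ℕ) (A : Finset (Fin K)) (v : SpiderV K) : ℝ :=
  if A = Finset.univ then 1 else potLin c g x A v

lemma potLin_atH (c : ℕ → ℝ) (g : ℝ → ℝ) (x : ℕ) (A : Finset (Fin K)) (j : Fin K) (r : ℕ) :
    potLin c g x A (atH r j) = potLeg c g x A j r := by
  cases r with
  | zero => simp [atH, potLin, potLeg]
  | succ r => simp [atH, potLin]

/-- Averaging operator on functions of the distance. -/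
noncomputable def avg (g : ℝ → ℝ) (y : ℝ) : ℝ := (g (y - 1) + g (y + 1)) / 2

lemma card_pos_of_ne {A : Finset (Fin K)} (hA : A ≠ Finset.univ) : 1 ≤ K - A.card := by
  have : A.card < K := by
    have := Finset.card_lt_card (Finset.ssubset_univ_iff.mpr hA)
    simpa using this
  omega

lemma opP_potLin (c : ℕ → ℝ) (g : ℝ → ℝ) (x : ℕ) (A : Finset (Fin K)) (hA : A ≠ Finset.univ)
    (v : SpiderV K) :
    opP (potLin c g x A) v = potLin c (avg g) x A v := by
  have hi := card_pos_of_ne hA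
  have hK : (0 : ℝ) < K := by
    have : 0 < K := by omega
    exact_mod_cast this
  cases v with
  | body =>
    simp only [opP, potLin, potLeg, avg]
    rw [← Finset.mul_sum, Finset.sum_add_distrib, Finset.sum_ite]
    simp only [Finset.sum_const, Finset.card_univ, Fintype.card_fin, nsmul_eq_mul, mul_zero,
      zero_add, Nat.cast_zero]
    have hc : (Finset.univ.filter (fun j => j ∉ A)).card = K - A.card := by
      have : (Finset.univ.filter (fun j => j ∉ A)) = Aᶜ := by ext; simp
      rw [this, Finset.card_compl, Fintype.card_fin]
    rw [hc]
    set i := K - A.card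
    have : (0 : ℝ) < i := by exact_mod_cast hi
    field_simp
    ring
  | leg r j =>
    have h1 := potLin_atH c g x A j r
    simp only [opP, h1]
    simp only [potLin, potLeg, avg]
    push_cast
    set y := (2 * ((K - A.card : ℕ) : ℝ) - 1) * x
    have e1 : y + ((r : ℝ) + 1 + 1) = y + (r + 1) + 1 := by ring
    have e2 : y - ((r : ℝ) + 1 + 1) = y - (r + 1) - 1 := by ring
    have e3 : y + (r : ℝ) = y + (r + 1) - 1 := by ring
    have e4 : y - (r : ℝ) = y - (r + 1) + 1 := by ring
    rw [e1, e2, e3, e4]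
    split_ifs <;> ring

/-- away from the boundary the potential of the next vertex is `potLin`; at the
boundary it is the value at the new stage. -/
lemma pot_next (c : ℕ → ℝ) (g : ℝ → ℝ) (x : ℕ) (hx : 1 ≤ x) (A : Finset (Fin K))
    (hA : A ≠ Finset.univ) (w : SpiderV K) (hw : ∀ j, j ∉ A → heightOnLeg j w ≤ x) :
    pot c g x (A ∪ newLegs x w) w = potLin c g x A w ∨
    ∃ i : ℕ, 1 ≤ i ∧ i ≤ K ∧
      potLin c g x A w = c i * (g (2 * i * x) + K / (2 * i) *
        (g ((2 * i - 2) * x) - g (2 * i * x))) ∧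
      pot c g x (A ∪ newLegs x w) w = if i = 1 then 1 else c (i - 1) * g ((2 * i - 2) * x) := by
  by_cases hsub : newLegs x w ⊆ A
  · left
    rw [Finset.union_eq_left.mpr hsub, pot, if_neg hA]
  · right
    obtain ⟨j, hj, hjA⟩ := Finset.not_subset.mp hsub
    simp only [newLegs, Finset.mem_filter, Finset.mem_univ, true_and] at hj
    have hwj := hw j hjA
    have hji : heightOnLeg j w = x := le_antisymm hwj hj
    cases w with
    | body => simp [heightOnLeg] at hji; omega
    | leg r j' =>
      by_cases hjj : j' = j
      swap
      · simp [heightOnLeg, hjj] at hji; omega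
      subst hjj
      simp only [heightOnLeg, if_true] at hji
      have hnew : newLegs x (SpiderV.leg r j') = {j'} := by
        ext j
        simp only [newLegs, Finset.mem_filter, Finset.mem_univ, true_and,
          Finset.mem_singleton]
        simp only [heightOnLeg]
        split_ifs with h
        · subst h; simp; omega
        · exact ⟨fun h1 => absurd h1 (by omega), fun h1 => absurd h1.symm h⟩
      have hi := card_pos_of_ne hA
      have hxr : (r : ℝ) + 1 = x := by exact_mod_cast hji
      refine ⟨K - A.card, hi, by omega, ?_, ?_⟩
      · simp only [potLin, potLeg, hjA, if_false, hxr]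
        congr 3
        · ring_nf
        · ring_nf
      · rw [hnew]
        have hcard : (A ∪ {j'}).card = A.card + 1 := by
          rw [Finset.union_comm, ← Finset.insert_eq, Finset.card_insert_of_notMem hjA]
        by_cases h1 : K - A.card = 1
        · rw [if_pos h1, pot, if_pos]
          rw [← Finset.card_eq_iff_eq_univ, Fintype.card_fin]; omega
        · rw [if_neg h1, pot, if_neg]
          · have hjm : j' ∈ A ∪ {j'} := by simp
            simp only [potLin, potLeg, hjm, if_true, hxr, add_zero, hcard]
            have e : K - (A.card + 1) = K - A.card - 1 := by omega
            rw [e, Nat.cast_sub hi]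
            congr 2
            push_cast
            ring
          · intro h
            rw [← Finset.card_eq_iff_eq_univ, Fintype.card_fin] at h; omega

lemma heightOnLeg_lt_of_notMem (x : ℕ) (v : SpiderV K) (l : List (SpiderV K)) (j : Fin K)
    (hj : j ∉ legsHit x (v :: l)) : heightOnLeg j v < x := by
  by_contra h
  apply hj
  simp only [legsHit, Finset.mem_filter, Finset.mem_univ, true_and]
  exact ⟨v, by simp, by omega⟩

lemma opP_one (hK : 1 ≤ K) (v : SpiderV K) : opP (fun _ => (1 : ℝ)) v = 1 := by
  have : (K : ℝ) ≠ 0 := by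
    have : K ≠ 0 := by omega
    exact_mod_cast this
  cases v <;> simp [opP, this]

lemma pot_step_lower (hK : 1 ≤ K) (c : ℕ → ℝ) (g : ℝ → ℝ) (x : ℕ) (hx : 1 ≤ x)
    (hb : ∀ i : ℕ, 1 ≤ i → i ≤ K → c i * (g (2 * i * x) + K / (2 * i) *
        (g ((2 * i - 2) * x) - g (2 * i * x))) ≤ c (i - 1) * g ((2 * i - 2) * x))
    (h1 : c 0 * g 0 ≤ 1) (v : SpiderV K) (l : List (SpiderV K)) :
    pot c (avg g) x (legsHit x (v :: l)) v
      ≤ opP (fun w => pot c g x (legsHit x (w :: v :: l)) w) v := by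
  by_cases hA : legsHit x (v :: l) = Finset.univ
  · rw [pot, if_pos hA, ← opP_one hK v]
    refine opP_mono v fun w _ => ?_
    rw [legsHit_cons, hA, pot, if_pos (by simp)]
  · rw [pot, if_neg hA, ← opP_potLin c g x _ hA]
    refine opP_mono v fun w hw => ?_
    rw [legsHit_cons x w]
    have hw' : ∀ j, j ∉ legsHit x (v :: l) → heightOnLeg j w ≤ x := by
      intro j hj
      have h1 := hw j
      have h2 := heightOnLeg_lt_of_notMem x v l j hj
      omega
    rcases pot_next c g x hx _ hA w hw' with h | ⟨i, hi1, hiK, e1, e2⟩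
    · rw [h]
    · rw [e1, e2]
      refine (hb i hi1 hiK).trans ?_
      split_ifs with h
      · subst h; norm_num; exact h1
      · exact le_rfl

lemma pot_step_upper (hK : 1 ≤ K) (c : ℕ → ℝ) (g : ℝ → ℝ) (x : ℕ) (hx : 1 ≤ x)
    (hb : ∀ i : ℕ, 1 ≤ i → i ≤ K → c (i - 1) * g ((2 * i - 2) * x) ≤
      c i * (g (2 * i * x) + K / (2 * i) * (g ((2 * i - 2) * x) - g (2 * i * x))))
    (h1 : 1 ≤ c 0 * g 0) (v : SpiderV K) (l : List (SpiderV K)) :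
    opP (fun w => pot c g x (legsHit x (w :: v :: l)) w) v
      ≤ pot c (avg g) x (legsHit x (v :: l)) v := by
  by_cases hA : legsHit x (v :: l) = Finset.univ
  · rw [pot, if_pos hA, ← opP_one hK v]
    refine opP_mono v fun w _ => ?_
    rw [legsHit_cons, hA, pot, if_pos (by simp)]
  · rw [pot, if_neg hA, ← opP_potLin c g x _ hA]
    refine opP_mono v fun w hw => ?_
    rw [legsHit_cons x w]
    have hw' : ∀ j, j ∉ legsHit x (v :: l) → heightOnLeg j w ≤ x := by
      intro j hj
      have h1 := hw j
      have h2 := heightOnLeg_lt_of_notMem x v l j hj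
      omega
    rcases pot_next c g x hx _ hA w hw' with h | ⟨i, hi1, hiK, e1, e2⟩
    · rw [h]
    · rw [e1, e2]
      refine le_trans ?_ (hb i hi1 hiK)
      split_ifs with h
      · subst h; norm_num; exact h1
      · exact le_rfl

lemma potLin_nonneg (c : ℕ → ℝ) (g : ℝ → ℝ) (hc : ∀ i, 0 ≤ c i) (hg : Antitone g)
    (x : ℕ) (A : Finset (Fin K)) (v : SpiderV K) :
    c (K - A.card) * g ((2 * ((K - A.card : ℕ) : ℝ) - 1) * x + ht v) ≤ potLin c g x A v := by
  cases v with
  | body => simp [potLin, ht]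
  | leg r j =>
    simp only [potLin, potLeg, ht]
    push_cast
    refine mul_le_mul_of_nonneg_left (le_add_of_nonneg_right ?_) (hc _)
    split_ifs
    · exact le_rfl
    · refine mul_nonneg (by positivity) (sub_nonneg.mpr (hg ?_))
      have : (0 : ℝ) ≤ r := by positivity
      linarith

lemma pot_nonneg (c : ℕ → ℝ) (g : ℝ → ℝ) (hc : ∀ i, 0 ≤ c i) (hg : Antitone g)
    (hg0 : ∀ y, 0 ≤ g y) (x : ℕ) (A : Finset (Fin K)) (v : SpiderV K) :
    0 ≤ pot c g x A v := by
  rw [pot]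
  split_ifs
  · exact zero_le_one
  · exact (mul_nonneg (hc _) (hg0 _)).trans (potLin_nonneg c g hc hg x A v)

lemma avg_antitone {g : ℝ → ℝ} (hg : Antitone g) : Antitone (avg g) := by
  intro a b h
  have h1 := hg (show a - 1 ≤ b - 1 by linarith)
  have h2 := hg (show a + 1 ≤ b + 1 by linarith)
  simp only [avg]; linarith

end potential

section estimates
variable {K : ℕ} {Ω : Type} [MeasurableSpace Ω] {P : Measure Ω} [IsProbabilityMeasure P]
    {W : ℕ → Ω → SpiderV K}

/-- All legs have been visited at height `x` by time `n`. -/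
def hitAll (W : ℕ → Ω → SpiderV K) (x n : ℕ) : Set Ω :=
  {ω | legsHit x (past W (n + 1) ω) = Finset.univ}

/-- Turn a real function of the current vertex and the history into a function on lists. -/
noncomputable def liftF (φ : ℕ → SpiderV K → List (SpiderV K) → ℝ) (s : ℕ) :
    List (SpiderV K) → ℝ≥0∞
  | [] => 0
  | v :: l => ENNReal.ofReal (φ s v l)

lemma prob_hitAll_le (hK : 1 ≤ K) (hmeas : ∀ n, Measurable (W n))
    (h0 : ∀ ω, W 0 ω = SpiderV.body)
    (hMarkov : ∀ n (h : ℕ → SpiderV K) (w : SpiderV K),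
      P ({ω | W (n + 1) ω = w} ∩ {ω | ∀ k ≤ n, W k ω = h k})
        = spiderKernel K (h n) w * P {ω | ∀ k ≤ n, W k ω = h k})
    (x n : ℕ) (hx : 1 ≤ x) (θ : ℝ) (hθ : 0 ≤ θ) :
    P (hitAll W x n) ≤
      ENNReal.ofReal (2 ^ K * Real.exp (n * θ ^ 2 / 2 - θ * ((2 * K - 1) * x))) := by
  set g : ℕ → ℝ → ℝ := fun s y => Real.cosh θ ^ s * Real.exp (-(θ * y)) with hg
  set c : ℕ → ℝ := fun i => 2 ^ i with hc
  have hcosh : 0 < Real.cosh θ := Real.cosh_pos θ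
  have hgs : ∀ s, avg (g s) = g (s + 1) := by
    intro s
    funext y
    simp only [avg, hg, Real.cosh_eq]
    have e1 : -(θ * (y - 1)) = -(θ * y) + θ := by ring
    have e2 : -(θ * (y + 1)) = -(θ * y) + -θ := by ring
    rw [e1, e2, Real.exp_add, Real.exp_add]
    ring
  have hanti : ∀ s, Antitone (g s) := by
    intro s a b hab
    simp only [hg]
    refine mul_le_mul_of_nonneg_left (Real.exp_le_exp.mpr ?_) (by positivity)
    nlinarith
  have hpos : ∀ s y, 0 ≤ g s y := by intro s y; simp only [hg]; positivity
  have hcp : ∀ i, 0 ≤ c i := by intro i; simp only [hc]; positivity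
  let F := liftF (K := K) (fun s v l => pot c (g s) x (legsHit x (v :: l)) v)
  have hF : ∀ s v l, ∑' w, spiderKernel K v w * F s (w :: v :: l) ≤ F (s + 1) (v :: l) := by
    intro s v l
    simp only [F, liftF]
    rw [kernel_sum (fun w => pot c (g s) x (legsHit x (w :: v :: l)) w)
      (fun w => pot_nonneg c (g s) hcp (hanti s) (hpos s) x _ w), ← hgs s]
    refine ENNReal.ofReal_le_ofReal (pot_step_upper hK c (g s) x hx ?_ ?_ v l)
    · intro i hi1 hiK
      have hab : g s (2 * i * x) ≤ g s ((2 * i - 2) * x) := by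
        apply hanti s
        have : (0 : ℝ) ≤ x := by positivity
        nlinarith
      set a := g s (2 * i * x)
      set b := g s ((2 * i - 2) * x)
      have hk : (1 : ℝ) / 2 ≤ K / (2 * i) := by
        have h1 : (1 : ℝ) ≤ i := by exact_mod_cast hi1
        have h2 : (i : ℝ) ≤ K := by exact_mod_cast hiK
        rw [div_le_div_iff₀ (by norm_num) (by linarith)]
        linarith
      have e : c i = 2 * c (i - 1) := by
        simp only [hc]
        rw [← pow_succ']
        congr 1; omega
      rw [e]
      have h3 : (1 / 2) * (b - a) ≤ K / (2 * i) * (b - a) :=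
        mul_le_mul_of_nonneg_right hk (by linarith)
      have h4 : b ≤ 2 * (a + K / (2 * i) * (b - a)) := by
        have := hpos s (2 * i * x)
        change 0 ≤ a at this
        linarith
      have := mul_le_mul_of_nonneg_left h4 (hcp (i - 1))
      linarith
    · simp only [hc, hg]
      simp
      exact one_le_pow₀ (Real.one_le_cosh θ)
  have h := iter_upper hmeas hMarkov F hF n 0
  have hR : ∀ ω, F n (past W (0 + 1) ω) = ENNReal.ofReal (c K * g n ((2 * K - 1) * x)) := by
    intro ω
    simp only [past, F, liftF, h0]
    have he : legsHit x [(SpiderV.body : SpiderV K)] = ∅ := by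
      rw [legsHit, Finset.filter_eq_empty_iff]
      rintro j - ⟨v, hv, h⟩
      rw [List.mem_singleton] at hv
      subst hv
      simp only [heightOnLeg] at h
      omega
    have hne : (∅ : Finset (Fin K)) ≠ Finset.univ := by
      intro h
      have := congrArg Finset.card h
      rw [Finset.card_empty, Finset.card_univ, Fintype.card_fin] at this
      omega
    rw [he, pot, if_neg hne]
    simp [potLin]
  simp_rw [hR] at h
  rw [lintegral_const, measure_univ, mul_one] at h
  have hms : MeasurableSet (hitAll W x n) :=
    measurable_past W hmeas (n + 1)
      (MeasurableSet.of_discrete (s := {l | legsHit x l = Finset.univ}))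
  have hLow : P (hitAll W x n) ≤ ∫⁻ ω, F 0 (past W (0 + n + 1) ω) ∂P := by
    rw [← lintegral_indicator_one hms]
    refine lintegral_mono fun ω => ?_
    by_cases hω : ω ∈ hitAll W x n
    · rw [Set.indicator_of_mem hω]
      rw [zero_add]
      simp only [hitAll, Set.mem_ofPred_eq] at hω
      simp only [past] at hω ⊢
      simp only [F, liftF]
      rw [pot, if_pos hω]
      simp
    · rw [Set.indicator_of_notMem hω]; exact zero_le
  refine hLow.trans (h.trans (ENNReal.ofReal_le_ofReal ?_))
  simp only [hc, hg]
  refine mul_le_mul_of_nonneg_left ?_ (by positivity)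
  rw [sub_eq_add_neg (_ / 2), Real.exp_add]
  refine mul_le_mul_of_nonneg_right ?_ (Real.exp_pos _).le
  calc Real.cosh θ ^ n ≤ Real.exp (θ ^ 2 / 2) ^ n :=
        pow_le_pow_left₀ hcosh.le (Real.cosh_le_exp_half_sq θ) n
    _ = Real.exp (n * θ ^ 2 / 2) := by rw [← Real.exp_nat_mul]; ring_nf

lemma prob_ht_le (hK : 1 ≤ K) (hmeas : ∀ n, Measurable (W n))
    (h0 : ∀ ω, W 0 ω = SpiderV.body)
    (hMarkov : ∀ n (h : ℕ → SpiderV K) (w : SpiderV K),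
      P ({ω | W (n + 1) ω = w} ∩ {ω | ∀ k ≤ n, W k ω = h k})
        = spiderKernel K (h n) w * P {ω | ∀ k ≤ n, W k ω = h k})
    (n : ℕ) (D : ℝ) (hD : 0 ≤ D) (θ : ℝ) (hθ : 0 ≤ θ) :
    P {ω | D ≤ ht (W n ω)} ≤
      ENNReal.ofReal (2 * Real.exp (n * θ ^ 2 / 2 - θ * D)) := by
  have hcosh : 0 < Real.cosh θ := Real.cosh_pos θ
  let F : ℕ → List (SpiderV K) → ℝ≥0∞ :=
    liftF (fun s v _ => Real.cosh θ ^ s * Real.cosh (θ * ht v) / Real.cosh (θ * D))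
  have hF : ∀ s v l, ∑' w, spiderKernel K v w * F s (w :: v :: l) ≤ F (s + 1) (v :: l) := by
    intro s v l
    simp only [F, liftF]
    rw [kernel_sum (fun w => Real.cosh θ ^ s * Real.cosh (θ * ht w) / Real.cosh (θ * D))
      (fun w => by
        have := Real.cosh_pos (θ * ht w)
        have := Real.cosh_pos (θ * D)
        positivity)]
    refine ENNReal.ofReal_le_ofReal (le_of_eq ?_)
    have hKp : (K : ℝ) ≠ 0 := by
      have : K ≠ 0 := by omega
      exact_mod_cast this
    cases v with
    | body =>
      simp [opP, ht]
      field_simp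
      ring
    | leg r j =>
      have hat : ht (atH r j) = r := by cases r <;> rfl
      simp only [opP, hat]
      simp only [ht]
      push_cast
      have e1 : θ * (r : ℝ) = θ * (r + 1) - θ := by ring
      have e2 : θ * ((r : ℝ) + 1 + 1) = θ * (r + 1) + θ := by ring
      rw [e1, e2, Real.cosh_sub, Real.cosh_add]
      ring
  have h := iter_upper hmeas hMarkov F hF n 0
  have hR : ∀ ω, F n (past W (0 + 1) ω) = ENNReal.ofReal (Real.cosh θ ^ n / Real.cosh (θ * D)) := by
    intro ω
    simp [past, F, liftF, h0, ht]
  simp_rw [hR] at h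
  rw [lintegral_const, measure_univ, mul_one] at h
  have hms : MeasurableSet {ω | D ≤ ht (W n ω)} :=
    hmeas n (MeasurableSet.of_discrete (s := {v | D ≤ ht v}))
  have hLow : P {ω | D ≤ ht (W n ω)} ≤ ∫⁻ ω, F 0 (past W (0 + n + 1) ω) ∂P := by
    rw [← lintegral_indicator_one hms]
    refine lintegral_mono fun ω => ?_
    by_cases hω : D ≤ ht (W n ω)
    · rw [Set.indicator_of_mem (by exact hω)]
      rw [zero_add]
      simp only [past, F, liftF, pow_zero, one_mul]
      rw [Pi.one_apply, ENNReal.one_le_ofReal, le_div_iff₀ (Real.cosh_pos _), one_mul,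
        Real.cosh_le_cosh, abs_of_nonneg (by positivity), abs_of_nonneg (by positivity)]
      exact mul_le_mul_of_nonneg_left hω hθ
    · rw [Set.indicator_of_notMem (by exact hω)]; exact zero_le
  refine hLow.trans (h.trans (ENNReal.ofReal_le_ofReal ?_))
  rw [sub_eq_add_neg (_ / 2), Real.exp_add]
  have h1 : Real.cosh θ ^ n ≤ Real.exp (n * θ ^ 2 / 2) := by
    calc Real.cosh θ ^ n ≤ Real.exp (θ ^ 2 / 2) ^ n :=
        pow_le_pow_left₀ hcosh.le (Real.cosh_le_exp_half_sq θ) n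
    _ = Real.exp (n * θ ^ 2 / 2) := by rw [← Real.exp_nat_mul]; ring_nf
  rw [div_le_iff₀ (Real.cosh_pos _)]
  have h2 : 1 ≤ 2 * Real.exp (-(θ * D)) * Real.cosh (θ * D) := by
    rw [Real.cosh_eq]
    have : Real.exp (-(θ * D)) * Real.exp (θ * D) = 1 := by rw [← Real.exp_add]; simp
    have h3 := Real.exp_pos (-(θ * D))
    nlinarith
  have h3 := Real.exp_pos (n * θ ^ 2 / 2)
  calc Real.cosh θ ^ n ≤ Real.exp (n * θ ^ 2 / 2) * 1 := by linarith
    _ ≤ Real.exp (n * θ ^ 2 / 2) * (2 * Real.exp (-(θ * D)) * Real.cosh (θ * D)) :=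
        mul_le_mul_of_nonneg_left h2 h3.le
    _ = _ := by ring

/-- `fW t y` is the probability that a simple random walk is at least `y` at time `t`. -/
noncomputable def fW : ℕ → ℝ → ℝ
  | 0 => fun y => if y ≤ 0 then 1 else 0
  | t + 1 => avg (fW t)

lemma fW_antitone (t : ℕ) : Antitone (fW t) := by
  induction t with
  | zero =>
    intro a b h
    simp only [fW]
    split_ifs <;> linarith
  | succ t ih => exact avg_antitone ih

lemma fW_nonneg (t : ℕ) (y : ℝ) : 0 ≤ fW t y := by
  induction t generalizing y with
  | zero => simp only [fW]; split_ifs <;> norm_num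
  | succ t ih =>
    have h1 := ih (y - 1)
    have h2 := ih (y + 1)
    simp only [fW, avg]; linarith

lemma fW_le_one (t : ℕ) (y : ℝ) : fW t y ≤ 1 := by
  induction t generalizing y with
  | zero => simp only [fW]; split_ifs <;> norm_num
  | succ t ih =>
    have h1 := ih (y - 1)
    have h2 := ih (y + 1)
    simp only [fW, avg]; linarith

lemma prob_hitAll_ge (hK : 1 ≤ K) (hmeas : ∀ n, Measurable (W n))
    (hMarkov : ∀ n (h : ℕ → SpiderV K) (w : SpiderV K),
      P ({ω | W (n + 1) ω = w} ∩ {ω | ∀ k ≤ n, W k ω = h k})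
        = spiderKernel K (h n) w * P {ω | ∀ k ≤ n, W k ω = h k})
    (x n N : ℕ) (hx : 1 ≤ x) (D : ℝ) (S : Set (List (SpiderV K)))
    (hS : ∀ v l, v :: l ∈ S → (ht v : ℝ) ≤ D) :
    ENNReal.ofReal ((1 / (K : ℝ)) ^ K * fW N (D + (2 * K - 1) * x)) * P (past W (n + 1) ⁻¹' S)
      ≤ P (past W (n + 1) ⁻¹' S ∩ hitAll W x (n + N)) := by
  set c : ℕ → ℝ := fun i => (1 / (K : ℝ)) ^ i with hc
  have hKr : (1 : ℝ) ≤ K := by exact_mod_cast hK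
  have hcp : ∀ i, 0 ≤ c i := by intro i; simp only [hc]; positivity
  let F := liftF (K := K) (fun s v l => pot c (fW s) x (legsHit x (v :: l)) v)
  have hF : ∀ s v l, F (s + 1) (v :: l) ≤ ∑' w, spiderKernel K v w * F s (w :: v :: l) := by
    intro s v l
    simp only [F, liftF]
    rw [kernel_sum (fun w => pot c (fW s) x (legsHit x (w :: v :: l)) w)
      (fun w => pot_nonneg c (fW s) hcp (fW_antitone s) (fW_nonneg s) x _ w)]
    refine ENNReal.ofReal_le_ofReal (pot_step_lower hK c (fW s) x hx ?_ ?_ v l)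
    · intro i hi1 hiK
      have hab : fW s (2 * i * x) ≤ fW s ((2 * i - 2) * x) := by
        apply fW_antitone s
        have : (0 : ℝ) ≤ x := by positivity
        nlinarith
      have ha := fW_nonneg s (2 * i * x)
      set a := fW s (2 * i * x)
      set b := fW s ((2 * i - 2) * x)
      have hk : (K : ℝ) / (2 * i) ≤ K := by
        have h1 : (1 : ℝ) ≤ i := by exact_mod_cast hi1
        exact div_le_self (by linarith) (by linarith)
      have e : c (i - 1) = K * c i := by
        simp only [hc]
        obtain ⟨m, rfl⟩ : ∃ m, i = m + 1 := ⟨i - 1, by omega⟩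
        simp only [Nat.add_sub_cancel, pow_succ]
        field_simp
      rw [e]
      have h3 : K / (2 * i) * (b - a) ≤ K * (b - a) :=
        mul_le_mul_of_nonneg_right hk (by linarith)
      have h4 : a + K / (2 * i) * (b - a) ≤ K * b := by nlinarith
      have := mul_le_mul_of_nonneg_left h4 (hcp i)
      linarith
    · simp only [hc, pow_zero, one_mul]
      exact fW_le_one s 0
  have h := iter_lower hmeas hMarkov F hF N n S
  have hmsS : MeasurableSet (past W (n + 1) ⁻¹' S) :=
    measurable_past W hmeas (n + 1) MeasurableSet.of_discrete
  have hms : MeasurableSet (hitAll W x (n + N)) :=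
    measurable_past W hmeas (n + N + 1)
      (MeasurableSet.of_discrete (s := {l | legsHit x l = Finset.univ}))
  have hup : ∫⁻ ω in past W (n + 1) ⁻¹' S, F 0 (past W (n + N + 1) ω) ∂P
      ≤ P (past W (n + 1) ⁻¹' S ∩ hitAll W x (n + N)) := by
    rw [Set.inter_comm, ← Measure.restrict_apply hms, ← lintegral_indicator_one hms]
    refine lintegral_mono fun ω => ?_
    by_cases hω : ω ∈ hitAll W x (n + N)
    · rw [Set.indicator_of_mem hω]
      simp only [hitAll, Set.mem_ofPred_eq] at hω
      simp only [past] at hω ⊢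
      simp only [F, liftF]
      rw [pot, if_pos hω]
      simp
    · rw [Set.indicator_of_notMem hω]
      simp only [hitAll, Set.mem_ofPred_eq] at hω
      simp only [past] at hω ⊢
      simp only [F, liftF]
      rw [pot, if_neg hω]
      set v := W (n + N) ω
      set l := past W (n + N) ω
      have hi := card_pos_of_ne hω
      have hir : (1 : ℝ) ≤ ((K - (legsHit x (v :: l)).card : ℕ) : ℝ) := by exact_mod_cast hi
      have hxr : (1 : ℝ) ≤ x := by exact_mod_cast hx
      have hz : ∀ y : ℝ, 0 < y → fW 0 y = 0 := by
        intro y hy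
        simp only [fW]
        rw [if_neg (not_le.mpr hy)]
      rw [nonpos_iff_eq_zero, ENNReal.ofReal_eq_zero]
      refine le_of_eq ?_
      have hlt := fun j => heightOnLeg_lt_of_notMem x v l j
      rcases v with _ | ⟨r, j⟩
      · simp only [potLin]
        rw [hz _ (by nlinarith), mul_zero]
      · simp only [potLin, potLeg]
        rw [hz _ (by have : (0 : ℝ) ≤ r := by positivity
                     nlinarith)]
        split_ifs with hj
        · simp
        · have h1 := hlt j hj
          simp only [heightOnLeg, if_true] at h1
          have h2 : (r : ℝ) + 1 < x := by exact_mod_cast h1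
          rw [hz _ (by nlinarith)]
          simp
  have hlow : ENNReal.ofReal ((1 / (K : ℝ)) ^ K * fW N (D + (2 * K - 1) * x))
        * P (past W (n + 1) ⁻¹' S)
      ≤ ∫⁻ ω in past W (n + 1) ⁻¹' S, F N (past W (n + 1) ω) ∂P := by
    rw [← setLIntegral_const]
    refine setLIntegral_mono' hmsS fun ω hω => ?_
    simp only [past, Set.mem_preimage] at hω ⊢
    have hv := hS _ _ hω
    simp only [F, liftF]
    refine ENNReal.ofReal_le_ofReal ?_
    have hck : ∀ i, i ≤ K → (1 / (K : ℝ)) ^ K ≤ c i := fun i hi =>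
      pow_le_pow_of_le_one (by positivity) (by rw [div_le_one (by linarith)]; exact hKr) hi
    rw [pot]
    split_ifs with hA
    · have h1 := hck 0 (by omega)
      simp only [hc, pow_zero] at h1
      exact mul_le_one₀ h1 (fW_nonneg _ _) (fW_le_one _ _)
    · refine le_trans ?_ (potLin_nonneg c (fW N) hcp (fW_antitone N) x _ _)
      refine mul_le_mul (hck _ (by omega)) (fW_antitone N ?_) (fW_nonneg _ _) (hcp _)
      have h2 : ((K - (legsHit x (W n ω :: past W n ω)).card : ℕ) : ℝ) ≤ K := by
        exact_mod_cast Nat.sub_le _ _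
      have hxr : (1 : ℝ) ≤ x := by exact_mod_cast hx
      nlinarith
  exact hlow.trans (h.trans hup)

end estimates

section tail

lemma fW_ge (θ w : ℝ) (hθ : 0 ≤ θ) (hw : 0 < w) (t : ℕ) (y : ℝ) :
    Real.exp (-(2 * θ * w)) * Real.cosh θ ^ t * Real.exp (-(θ * y)) *
      (1 - ((-y + t * Real.tanh θ - w) ^ 2 + t * (1 - Real.tanh θ ^ 2)) / w ^ 2) ≤ fW t y := by
  have hC := Real.cosh_pos θ
  induction t generalizing y with
  | zero =>
    simp only [pow_zero, mul_one, Nat.cast_zero, zero_mul, add_zero]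
    by_cases h1 : 0 < y ∨ y < -(2 * w)
    · have h2 : 1 - (-y - w) ^ 2 / w ^ 2 ≤ 0 := by
        rw [sub_nonpos, le_div_iff₀ (by positivity)]
        rcases h1 with h1 | h1 <;> nlinarith
      refine (mul_nonpos_of_nonneg_of_nonpos (by positivity) h2).trans (fW_nonneg 0 y)
    · push Not at h1
      have e : fW 0 y = 1 := by simp [fW, h1.1]
      rw [e, ← Real.exp_add]
      refine mul_le_one₀ (Real.exp_le_one_iff.mpr ?_) ?_ ?_
      · nlinarith
      · rw [sub_nonneg, div_le_one (by positivity)]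
        nlinarith
      · rw [sub_le_self_iff]; positivity
  | succ t ih =>
    have h1 := ih (y - 1)
    have h2 := ih (y + 1)
    have e1 : Real.exp (-(θ * (y - 1))) = Real.exp (-(θ * y)) *
        (Real.cosh θ * (1 + Real.tanh θ)) := by
      have : Real.cosh θ * (1 + Real.tanh θ) = Real.exp θ := by
        rw [Real.tanh_eq_sinh_div_cosh, ← Real.cosh_add_sinh]; field_simp
      rw [this, ← Real.exp_add]; ring_nf
    have e2 : Real.exp (-(θ * (y + 1))) = Real.exp (-(θ * y)) *
        (Real.cosh θ * (1 - Real.tanh θ)) := by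
      have : Real.cosh θ * (1 - Real.tanh θ) = Real.exp (-θ) := by
        rw [Real.tanh_eq_sinh_div_cosh, ← Real.cosh_sub_sinh]; field_simp
      rw [this, ← Real.exp_add]; ring_nf
    rw [e1] at h1
    rw [e2] at h2
    simp only [fW, avg]
    push_cast
    generalize Real.tanh θ = τ at *
    generalize Real.exp (-(2 * θ * w)) = a at *
    generalize Real.exp (-(θ * y)) = b at *
    generalize Real.cosh θ = C at *
    refine le_trans (le_of_eq ?_) (div_le_div_of_nonneg_right (add_le_add h1 h2) zero_le_two)
    field_simp
    ring

lemma exists_theta (τ : ℝ) (h0 : 0 ≤ τ) (h1 : τ ≤ 1 / 2) :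
    ∃ θ : ℝ, 0 ≤ θ ∧ Real.tanh θ = τ ∧ θ ≤ τ * (1 + τ) ∧ Real.exp (τ ^ 2 / 2) ≤ Real.cosh θ := by
  set θ := (Real.log (1 + τ) - Real.log (1 - τ)) / 2 with hθ
  have hp : 0 < 1 + τ := by linarith
  have hm : 0 < 1 - τ := by linarith
  have e2 : Real.exp θ ^ 2 = (1 + τ) / (1 - τ) := by
    rw [← Real.exp_nat_mul, hθ]
    have : ((2 : ℕ) : ℝ) * ((Real.log (1 + τ) - Real.log (1 - τ)) / 2)
        = Real.log (1 + τ) - Real.log (1 - τ) := by push_cast; ring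
    rw [this, Real.exp_sub, Real.exp_log hp, Real.exp_log hm]
  have htanh : Real.tanh θ = τ := by
    rw [Real.tanh_eq_sinh_div_cosh, Real.sinh_eq, Real.cosh_eq, Real.exp_neg]
    have hE := Real.exp_pos θ
    generalize Real.exp θ = E at *
    have : E ^ 2 * (1 - τ) = 1 + τ := by rw [e2]; field_simp
    have h3 : (0 : ℝ) < E ^ 2 + 1 := by positivity
    field_simp
    linarith
  refine ⟨θ, ?_, htanh, ?_, ?_⟩
  · have := Real.log_le_log hm (show 1 - τ ≤ 1 + τ by linarith)
    rw [hθ]; linarith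
  · have h3 := Real.log_le_sub_one_of_pos hp
    have h4 := Real.log_le_sub_one_of_pos (inv_pos.mpr hm)
    rw [Real.log_inv] at h4
    have h5 : (1 - τ)⁻¹ ≤ 1 + τ + 2 * τ ^ 2 := by
      rw [inv_le_iff_one_le_mul₀ hm]
      nlinarith [mul_nonneg h0 h0, mul_nonneg (mul_nonneg h0 h0) (show 0 ≤ 1 - 2 * τ by linarith)]
    rw [hθ]; nlinarith
  · have hC := Real.cosh_pos θ
    have h3 : Real.cosh θ ^ 2 * (1 - τ ^ 2) = 1 := by
      have h4 := Real.cosh_sq θ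
      rw [← htanh, Real.tanh_eq_sinh_div_cosh]
      field_simp
      linarith
    have h4 : 1 - τ ^ 2 ≤ Real.exp (-τ ^ 2) := by
      have := Real.add_one_le_exp (-τ ^ 2); linarith
    have h5 : Real.exp (τ ^ 2 / 2) ^ 2 * Real.exp (-τ ^ 2) = 1 := by
      rw [← Real.exp_nat_mul, ← Real.exp_add, Real.exp_eq_one_iff]; push_cast; ring
    have h6 : Real.exp (τ ^ 2 / 2) ^ 2 ≤ Real.cosh θ ^ 2 := by
      have h7 := Real.exp_pos (-τ ^ 2)
      have h8 : Real.exp (τ ^ 2 / 2) ^ 2 * Real.exp (-τ ^ 2)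
          ≤ Real.cosh θ ^ 2 * Real.exp (-τ ^ 2) := by
        rw [h5, ← h3]; exact mul_le_mul_of_nonneg_left h4 (by positivity)
      exact le_of_mul_le_mul_right h8 h7
    exact (pow_le_pow_iff_left₀ (Real.exp_pos _).le hC.le two_ne_zero).mp h6

lemma fW_ge_exp (N : ℕ) (s : ℝ) (hN : 1 ≤ N) (hs : 2 ≤ s) (hsN : s / Real.sqrt N ≤ 1 / 2) :
    Real.exp (s ^ 2 / 2 - s * (s + 2) * (1 + s / Real.sqrt N) - 1)
      ≤ fW N (Real.sqrt N * (s - 2)) := by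
  set q := Real.sqrt N with hq
  have hNr : (1 : ℝ) ≤ N := by exact_mod_cast hN
  have hq2 : q ^ 2 = N := Real.sq_sqrt (by linarith)
  have hqp : 0 < q := Real.sqrt_pos.mpr (by linarith)
  obtain ⟨θ, hθ0, hτ, hθ1, hcosh⟩ := exists_theta (s / q) (by positivity) hsN
  have h := fW_ge θ (2 * q) hθ0 (by positivity) N (q * (s - 2))
  refine le_trans ?_ h
  rw [hτ]
  have hNs : (N : ℝ) * (s / q) = q * s := by rw [← hq2]; field_simp
  have e1 : -(q * (s - 2)) + N * (s / q) - 2 * q = 0 := by rw [hNs]; ring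
  rw [e1]
  have hb : (3 / 4 : ℝ) ≤ 1 - (0 ^ 2 + N * (1 - (s / q) ^ 2)) / (2 * q) ^ 2 := by
    have : (0 ^ 2 + N * (1 - (s / q) ^ 2)) / (2 * q) ^ 2 = (1 - (s / q) ^ 2) / 4 := by
      rw [← hq2]; field_simp; ring
    rw [this]
    have := sq_nonneg (s / q)
    linarith
  have he : Real.exp (-1) ≤ 3 / 4 := by
    have := Real.exp_neg_one_lt_d9
    linarith
  have hc : Real.exp (s ^ 2 / 2) ≤ Real.cosh θ ^ N := by
    calc Real.exp (s ^ 2 / 2) = Real.exp ((s / q) ^ 2 / 2) ^ N := by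
          rw [← Real.exp_nat_mul, ← hq2]; congr 1; field_simp
      _ ≤ _ := pow_le_pow_left₀ (Real.exp_pos _).le hcosh N
  have hmain : Real.exp (-(s * (s + 2) * (1 + s / q)))
      ≤ Real.exp (-(2 * θ * (2 * q))) * Real.exp (-(θ * (q * (s - 2)))) := by
    rw [← Real.exp_add]
    apply Real.exp_le_exp.mpr
    have h1 : θ * (q * (s + 2)) ≤ s / q * (1 + s / q) * (q * (s + 2)) :=
      mul_le_mul_of_nonneg_right hθ1 (by positivity)
    have h2 : s / q * (1 + s / q) * (q * (s + 2)) = s * (s + 2) * (1 + s / q) := by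
      field_simp
    linarith
  calc Real.exp (s ^ 2 / 2 - s * (s + 2) * (1 + s / q) - 1)
      = Real.exp (-(s * (s + 2) * (1 + s / q))) * Real.exp (s ^ 2 / 2) * Real.exp (-1) := by
        rw [← Real.exp_add, ← Real.exp_add]; ring_nf
    _ ≤ (Real.exp (-(2 * θ * (2 * q))) * Real.exp (-(θ * (q * (s - 2))))) * Real.cosh θ ^ N
          * (1 - (0 ^ 2 + N * (1 - (s / q) ^ 2)) / (2 * q) ^ 2) := by
        gcongr
        exact he.trans hb
    _ = _ := by ring

lemma asymp_aux (β d u q σ s : ℝ) (h0 : 0 ≤ β) (h1 : β < 1) (hd : d = 1 - β ^ 2)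
    (hu200 : 200 ≤ u) (hdu : 200 ≤ d * u) (hqu : u ^ 4 ≤ q) (hσ2 : σ ^ 2 = 2) (hσ0 : 0 ≤ σ)
    (hs : s = β * σ * u + 2) :
    2 ≤ s ∧ s / q ≤ 1 / 2 ∧ -u ^ 2 ≤ s ^ 2 / 2 - s * (s + 2) * (1 + s / q) - 1 := by
  have hσ1 : σ ≤ 3 / 2 := by nlinarith
  have hbs : β * σ ≤ 3 / 2 := by nlinarith
  have hbs0 : 0 ≤ β * σ := by positivity
  have hup : 0 < u := by linarith
  have hbu := mul_nonneg hbs0 hup.le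
  have hbu2 := mul_le_mul_of_nonneg_right hbs hup.le
  have hs2 : 2 ≤ s := by linarith
  have hs3 : s ≤ 2 * u := by linarith
  have hqp : 0 < q := lt_of_lt_of_le (by positivity) hqu
  have hsq : s / q ≤ 2 / u ^ 3 := by
    rw [div_le_div_iff₀ hqp (by positivity)]
    have := mul_le_mul_of_nonneg_right hs3 (show 0 ≤ u ^ 3 by positivity)
    have e : 2 * u * u ^ 3 = 2 * u ^ 4 := by ring
    linarith
  have hu3 : (200 : ℝ) ^ 3 ≤ u ^ 3 := pow_le_pow_left₀ (by norm_num) hu200 3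
  have hsq' : s / q ≤ 1 / 2 := by
    refine hsq.trans ?_
    rw [div_le_div_iff₀ (by positivity) (by norm_num)]
    linarith
  refine ⟨hs2, hsq', ?_⟩
  have h5 : s * (s + 2) * (s / q) ≤ 12 := by
    have h6 : s * (s + 2) ≤ 2 * u * (3 * u) :=
      mul_le_mul hs3 (by linarith) (by linarith) (by linarith)
    have h7 : s * (s + 2) * (s / q) ≤ 2 * u * (3 * u) * (2 / u ^ 3) :=
      mul_le_mul h6 hsq (div_nonneg (by linarith) hqp.le) (by positivity)
    refine h7.trans ?_
    have : 2 * u * (3 * u) * (2 / u ^ 3) = 12 / u := by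
      field_simp; ring
    rw [this, div_le_iff₀ (by linarith)]
    linarith
  have h8 : s ^ 2 = β ^ 2 * σ ^ 2 * u ^ 2 + 4 * (β * σ * u) + 4 := by
    rw [hs]; ring
  have h9 : β ^ 2 * σ ^ 2 * u ^ 2 = 2 * u ^ 2 - 2 * (d * u ^ 2) := by
    rw [hσ2, hd]; ring
  have h10 : 200 * u ≤ d * u ^ 2 := by
    have := mul_le_mul_of_nonneg_right hdu hup.le
    have e : d * u * u = d * u ^ 2 := by ring
    linarith
  have h11 : s * (s + 2) * (1 + s / q) = s ^ 2 + 2 * s + s * (s + 2) * (s / q) := by ring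
  rw [h11]
  linarith

lemma fW_asymp (β : ℝ) (h0 : 0 ≤ β) (h1 : β < 1) :
    ∃ l0 : ℝ, 1 ≤ l0 ∧ ∀ l, l0 ≤ l → ∀ N : ℕ, l ^ 4 ≤ N →
      Real.exp (-l) ≤ fW N (β * Real.sqrt (2 * N * l)) := by
  set d := 1 - β ^ 2 with hd
  have hdp : 0 < d := by nlinarith
  have hd1 : d ≤ 1 := by nlinarith [sq_nonneg β]
  refine ⟨(200 / d) ^ 2, ?_, ?_⟩
  · have : 1 ≤ 200 / d := by rw [le_div_iff₀ hdp]; linarith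
    nlinarith
  intro l hl N hN
  set u := Real.sqrt l with hu
  have h200 : 200 ≤ 200 / d := by rw [le_div_iff₀ hdp]; nlinarith
  have hul : 200 / d ≤ u := Real.le_sqrt_of_sq_le hl
  have hu2 : u ^ 2 = l := Real.sq_sqrt (by nlinarith)
  have hu200 : 200 ≤ u := h200.trans hul
  have hdu : 200 ≤ d * u := by
    rw [div_le_iff₀ hdp] at hul; linarith
  have hNr : (1 : ℝ) ≤ N := by
    refine le_trans (one_le_pow₀ ?_) hN
    nlinarith
  have hN1 : 1 ≤ N := by exact_mod_cast hNr
  set q := Real.sqrt N with hq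
  have hqu : u ^ 4 ≤ q := by
    apply Real.le_sqrt_of_sq_le
    calc (u ^ 4) ^ 2 = (u ^ 2) ^ 4 := by ring
      _ ≤ (N : ℝ) := by rw [hu2]; exact hN
  obtain ⟨σ, hσ⟩ : ∃ σ, σ = Real.sqrt 2 := ⟨_, rfl⟩
  have hσ2 : σ ^ 2 = 2 := by rw [hσ]; exact Real.sq_sqrt (by norm_num)
  have hσ0 : 0 ≤ σ := by rw [hσ]; exact Real.sqrt_nonneg 2
  obtain ⟨s, hs⟩ : ∃ s, s = β * σ * u + 2 := ⟨_, rfl⟩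
  obtain ⟨hs2, hsq', hfin⟩ := asymp_aux β d u q σ s h0 h1 hd hu200 hdu hqu hσ2 hσ0 hs
  have h := fW_ge_exp N s hN1 hs2 hsq'
  have e : β * Real.sqrt (2 * N * l) = Real.sqrt N * (s - 2) := by
    rw [Real.sqrt_mul (by positivity), Real.sqrt_mul (by norm_num), hs, ← hσ, ← hu]
    ring
  rw [e]
  refine le_trans (Real.exp_le_exp.mpr ?_) h
  rw [← hu2]
  exact hfin

end tail

section final

set_option linter.unusedSectionVars false

variable {K : ℕ} {Ω : Type} [MeasurableSpace Ω] {P : Measure Ω} [IsProbabilityMeasure P]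
  {W : ℕ → Ω → SpiderV K}

/-- The minimum over the legs of the maximal height up to time `n`. -/
noncomputable def mn (W : ℕ → Ω → SpiderV K) (n : ℕ) (ω : Ω) : ℕ :=
  sInf (Set.range fun j : Fin K => (Finset.range (n + 1)).sup fun t => heightOnLeg j (W t ω))

lemma mem_hitAll_iff (hK : 1 ≤ K) (x n : ℕ) (hx : 1 ≤ x) (ω : Ω) :
    ω ∈ hitAll W x n ↔ x ≤ mn W n ω := by
  have : Nonempty (Fin K) := ⟨⟨0, hK⟩⟩
  have h1 : x ≤ mn W n ω ↔ ∀ j : Fin K,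
      x ≤ (Finset.range (n + 1)).sup fun t => heightOnLeg j (W t ω) := by
    unfold mn
    constructor
    · intro h j
      exact h.trans (Nat.sInf_le ⟨j, rfl⟩)
    · intro h
      obtain ⟨j, hj⟩ := Nat.sInf_mem (Set.range_nonempty
        (fun j : Fin K => (Finset.range (n + 1)).sup fun t => heightOnLeg j (W t ω)))
      rw [← hj]; exact h j
  rw [h1]
  unfold hitAll
  rw [Set.mem_ofPred_eq, Finset.eq_univ_iff_forall]
  refine forall_congr' fun j => ?_
  rw [legsHit, Finset.mem_filter, Finset.le_sup_iff (by exact hx)]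
  simp only [Finset.mem_univ, true_and, mem_past, Finset.mem_range]
  constructor
  · rintro ⟨v, ⟨t, ht, rfl⟩, h⟩; exact ⟨t, ht, h⟩
  · rintro ⟨t, ht, h⟩; exact ⟨_, ⟨t, ht, rfl⟩, h⟩

lemma mn_mono (hK : 1 ≤ K) (ω : Ω) : Monotone (fun n => mn W n ω) := by
  have : Nonempty (Fin K) := ⟨⟨0, hK⟩⟩
  intro a b hab
  change mn W a ω ≤ mn W b ω
  unfold mn
  obtain ⟨j, hj⟩ := Nat.sInf_mem (Set.range_nonempty
    (fun j : Fin K => (Finset.range (b + 1)).sup fun t => heightOnLeg j (W t ω)))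
  rw [← hj]
  have h1 : sInf (Set.range fun j : Fin K =>
      (Finset.range (a + 1)).sup fun t => heightOnLeg j (W t ω))
      ≤ (Finset.range (a + 1)).sup fun t => heightOnLeg j (W t ω) := Nat.sInf_le ⟨j, rfl⟩
  have h2 : a + 1 ≤ b + 1 := by omega
  exact h1.trans (Finset.sup_mono (Finset.range_mono h2))

lemma bc_first (A : ℕ → Set Ω) (b : ℕ → ℝ) (hb : Summable b)
    (h : ∀ᶠ k in atTop, P (A k) ≤ ENNReal.ofReal (b k)) :
    ∀ᵐ ω ∂P, ∀ᶠ k in atTop, ω ∉ A k := by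
  obtain ⟨k0, hk0⟩ := eventually_atTop.mp h
  have h1 : ∑' k, P (A (k + k0)) ≠ ∞ := by
    refine ne_top_of_le_ne_top ((summable_nat_add_iff k0).mpr hb).tsum_ofReal_ne_top
      (ENNReal.tsum_le_tsum fun k => hk0 (k + k0) (by omega))
  filter_upwards [ae_eventually_notMem h1] with ω hω
  obtain ⟨k1, hk1⟩ := eventually_atTop.mp hω
  refine eventually_atTop.mpr ⟨k1 + k0, fun k hk => ?_⟩
  have := hk1 (k - k0) (by omega)
  rwa [Nat.sub_add_cancel (by omega)] at this

/-- Normalisation. -/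
noncomputable def psi (n : ℕ) : ℝ := Real.sqrt (2 * n * Real.log (Real.log n))

lemma psi_mono {a b : ℕ} (ha : 3 ≤ a) (hab : a ≤ b) : psi a ≤ psi b := by
  unfold psi
  have ha' : (3 : ℝ) ≤ a := by exact_mod_cast ha
  have hab' : (a : ℝ) ≤ b := by exact_mod_cast hab
  have h1 : 1 ≤ Real.log a := by
    rw [Real.le_log_iff_exp_le (by linarith)]
    have := Real.exp_one_lt_d9; linarith
  have h2 : Real.log a ≤ Real.log b := Real.log_le_log (by linarith) hab'
  have h3 : 0 ≤ Real.log (Real.log a) := Real.log_nonneg h1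
  have h4 : Real.log (Real.log a) ≤ Real.log (Real.log b) := Real.log_le_log (by linarith) h2
  apply Real.sqrt_le_sqrt
  gcongr

lemma eventually_upper_params (q : ℝ) (hq : 1 < q) : ∀ᶠ k : ℕ in atTop,
    3 ≤ ⌈q ^ k⌉₊ ∧ (⌈q ^ (k + 1)⌉₊ : ℝ) ≤ q ^ 2 * ⌈q ^ k⌉₊ ∧ 1 < k * Real.log q := by
  have hq0 : 0 < Real.log q := Real.log_pos hq
  have t1 : Tendsto (fun k : ℕ => q ^ k) atTop atTop := tendsto_pow_atTop_atTop_of_one_lt hq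
  have t2 : Tendsto (fun k : ℕ => (k : ℝ) * Real.log q) atTop atTop :=
    tendsto_natCast_atTop_atTop.atTop_mul_const hq0
  filter_upwards [t1.eventually_ge_atTop 3, t1.eventually_ge_atTop (1 / (q - 1)),
    t2.eventually_gt_atTop 1] with k h1 h2 h3
  refine ⟨?_, ?_, h3⟩
  · have := h1.trans (Nat.le_ceil (q ^ k)); exact_mod_cast this
  · have h4 := (Nat.ceil_lt_add_one (show 0 ≤ q ^ (k + 1) by positivity)).le
    have h5 := Nat.le_ceil (q ^ k)
    have hq1 : 0 < q - 1 := by linarith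
    rw [div_le_iff₀ hq1] at h2
    have hk : 0 < q ^ k := by positivity
    calc (⌈q ^ (k + 1)⌉₊ : ℝ) ≤ q ^ (k + 1) + 1 := h4
      _ ≤ q ^ (k + 1) + q ^ k * (q - 1) * q := by nlinarith
      _ = q ^ 2 * q ^ k := by ring
      _ ≤ _ := by gcongr

lemma exponent_aux (n1 n0 y p LL L q : ℝ) (h1 : 0 < n1) (h0 : 0 < n0) (hr : n1 ≤ q ^ 2 * n0)
    (hp : 0 ≤ p) (hq : 0 < q) (hy : q ^ 2 * p ≤ y) (hpp : p ^ 2 = 2 * n0 * LL) (hL : L ≤ LL)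
    (hL0 : 0 ≤ L) : n1 * (y / n1) ^ 2 / 2 - y / n1 * y ≤ -(q ^ 2 * L) := by
  have e : n1 * (y / n1) ^ 2 / 2 - y / n1 * y = -(y ^ 2 / (2 * n1)) := by
    field_simp; ring
  rw [e, neg_le_neg_iff, le_div_iff₀ (by positivity)]
  have hLL : 0 ≤ LL := hL0.trans hL
  have hy2 : (q ^ 2 * p) ^ 2 ≤ y ^ 2 := pow_le_pow_left₀ (by positivity) hy 2
  calc q ^ 2 * L * (2 * n1) ≤ q ^ 2 * LL * (2 * (q ^ 2 * n0)) := by gcongr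
    _ = (q ^ 2) ^ 2 * (2 * n0 * LL) := by ring
    _ = (q ^ 2 * p) ^ 2 := by rw [← hpp]; ring
    _ ≤ y ^ 2 := hy2

lemma upper_bound (hK : 1 ≤ K) (hmeas : ∀ n, Measurable (W n))
    (h0 : ∀ ω, W 0 ω = SpiderV.body)
    (hMarkov : ∀ n (h : ℕ → SpiderV K) (w : SpiderV K),
      P ({ω | W (n + 1) ω = w} ∩ {ω | ∀ k ≤ n, W k ω = h k})
        = spiderKernel K (h n) w * P {ω | ∀ k ≤ n, W k ω = h k})
    (q : ℝ) (hq : 1 < q) :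
    ∀ᵐ ω ∂P, ∀ᶠ n in atTop, (mn W n ω : ℝ) ≤ q ^ 2 / (2 * K - 1) * psi n := by
  have hA : (0 : ℝ) < 2 * K - 1 := by
    have : (1 : ℝ) ≤ K := by exact_mod_cast hK
    linarith
  have hlq : 0 < Real.log q := Real.log_pos hq
  set nk : ℕ → ℕ := fun k => ⌈q ^ k⌉₊ with hnk
  set B : ℕ → ℝ := fun k => q ^ 2 / (2 * K - 1) * psi (nk k) with hB
  set xk : ℕ → ℕ := fun k => ⌈B k⌉₊ with hxk
  set b : ℕ → ℝ := fun k => 2 ^ K * ((Real.log q) ^ (-q ^ 2) * (k : ℝ) ^ (-q ^ 2)) with hb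
  have hbs : Summable b := by
    apply Summable.mul_left
    apply Summable.mul_left
    apply Real.summable_nat_rpow.mpr
    nlinarith
  have hev := eventually_upper_params q hq
  have hpos : ∀ k, 3 ≤ nk k → 1 < k * Real.log q →
      Real.log (k * Real.log q) ≤ Real.log (Real.log (nk k)) ∧ 0 < psi (nk k) := by
    intro k h3 hk
    have h1 : k * Real.log q ≤ Real.log (nk k) := by
      rw [← Real.log_pow]
      exact Real.log_le_log (by positivity) (Nat.le_ceil _)
    have h2 : Real.log (k * Real.log q) ≤ Real.log (Real.log (nk k)) :=
      Real.log_le_log (by linarith) h1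
    refine ⟨h2, ?_⟩
    have h4 : 0 < Real.log (k * Real.log q) := Real.log_pos hk
    have h5 : (0 : ℝ) < nk k := by exact_mod_cast (by omega : 0 < nk k)
    apply Real.sqrt_pos.mpr
    have : 0 < Real.log (Real.log (nk k)) := by linarith
    positivity
  have hbc : ∀ᵐ ω ∂P, ∀ᶠ k in atTop, ω ∉ hitAll W (xk k) (nk (k + 1)) := by
    apply bc_first _ b hbs
    filter_upwards [hev] with k hk
    obtain ⟨h3, hr, hk1⟩ := hk
    obtain ⟨hLL, hps⟩ := hpos k h3 hk1
    have hBp : 0 < B k := by simp only [hB]; positivity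
    have hx1 : 1 ≤ xk k := Nat.ceil_pos.mpr hBp
    have hBx : B k ≤ xk k := Nat.le_ceil _
    have hn1 : (0 : ℝ) < nk (k + 1) := by
      have : 0 < nk (k + 1) := Nat.ceil_pos.mpr (by positivity)
      exact_mod_cast this
    have hn0 : (0 : ℝ) < nk k := by
      have : 0 < nk k := lt_of_lt_of_le (by norm_num) h3
      exact_mod_cast this
    refine (prob_hitAll_le hK hmeas h0 hMarkov (xk k) (nk (k + 1)) hx1
      ((2 * K - 1) * xk k / nk (k + 1)) (by positivity)).trans ?_
    apply ENNReal.ofReal_le_ofReal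
    simp only [hb]
    refine mul_le_mul_of_nonneg_left ?_ (by positivity)
    have e1 : (Real.log q) ^ (-q ^ 2) * (k : ℝ) ^ (-q ^ 2)
        = Real.exp (-(q ^ 2 * Real.log (k * Real.log q))) := by
      rw [mul_comm, ← Real.mul_rpow (by positivity) hlq.le, Real.rpow_def_of_pos (by linarith)]
      congr 1; ring
    rw [e1]
    apply Real.exp_le_exp.mpr
    have hpsq : psi (nk k) ^ 2 = 2 * nk k * Real.log (Real.log (nk k)) := by
      apply Real.sq_sqrt
      by_contra hneg
      push Not at hneg
      have : psi (nk k) = 0 := Real.sqrt_eq_zero_of_nonpos hneg.le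
      linarith
    have hAB : q ^ 2 * psi (nk k) ≤ (2 * K - 1) * xk k := by
      have : (2 * K - 1) * B k ≤ (2 * K - 1) * xk k := mul_le_mul_of_nonneg_left hBx hA.le
      refine le_trans (le_of_eq ?_) this
      simp only [hB]
      field_simp
    exact exponent_aux (nk (k + 1)) (nk k) _ (psi (nk k)) _ _ q hn1 hn0 hr hps.le (by linarith)
      hAB hpsq hLL (Real.log_pos hk1).le
  filter_upwards [hbc] with ω hω
  have tk : Tendsto (fun n : ℕ => ⌊Real.logb q n⌋₊) atTop atTop :=
    tendsto_nat_floor_atTop.comp ((Real.tendsto_logb_atTop hq).comp tendsto_natCast_atTop_atTop)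
  filter_upwards [tk.eventually hω, tk.eventually hev, eventually_ge_atTop 1] with n h1 h2 h3
  obtain ⟨k, hk⟩ : ∃ k, k = ⌊Real.logb q n⌋₊ := ⟨_, rfl⟩
  rw [← hk] at h1 h2
  obtain ⟨h3k, hr, hk1⟩ := h2
  obtain ⟨hLL, hps⟩ := hpos k h3k hk1
  have hn : (0 : ℝ) < n := by exact_mod_cast h3
  have hlog0 : 0 ≤ Real.logb q n := Real.logb_nonneg hq (by exact_mod_cast h3)
  have hlow : nk k ≤ n := by
    apply Nat.ceil_le.mpr
    have h5 : (k : ℝ) ≤ Real.logb q n := by rw [hk]; exact Nat.floor_le hlog0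
    rw [Real.le_logb_iff_rpow_le hq hn, Real.rpow_natCast] at h5
    exact h5
  have hup : n ≤ nk (k + 1) := by
    have h5 : Real.logb q n ≤ ((k + 1 : ℕ) : ℝ) := by
      rw [hk]; push_cast; exact (Nat.lt_floor_add_one _).le
    rw [Real.logb_le_iff_le_rpow hq hn, Real.rpow_natCast] at h5
    have := h5.trans (Nat.le_ceil _)
    exact_mod_cast this
  have hBp : 0 < B k := by simp only [hB]; positivity
  have hx1 : 1 ≤ xk k := Nat.ceil_pos.mpr hBp
  rw [mem_hitAll_iff hK _ _ hx1, not_le] at h1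
  have h6 : mn W n ω < ⌈B k⌉₊ := lt_of_le_of_lt (mn_mono hK ω hup) h1
  have h7 : (mn W n ω : ℝ) < B k := Nat.lt_ceil.mp h6
  refine h7.le.trans ?_
  simp only [hB]
  exact mul_le_mul_of_nonneg_left (psi_mono h3k hlow) (by positivity)

lemma past_eq_of (n : ℕ) (ω ω' : Ω) (h : past W n ω = past W n ω') :
    ∀ t < n, W t ω = W t ω' := by
  induction n with
  | zero => intro t ht; omega
  | succ n ih =>
    simp only [past, List.cons.injEq] at h
    intro t ht
    rcases Nat.lt_succ_iff_lt_or_eq.mp ht with h1 | h1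
    · exact ih h.2 t h1
    · rw [h1]; exact h.1

lemma past_congr (n : ℕ) (ω ω' : Ω) (h : ∀ t < n, W t ω = W t ω') :
    past W n ω = past W n ω' := by
  induction n with
  | zero => rfl
  | succ n ih =>
    simp only [past]
    rw [h n (by omega), ih fun t ht => h t (by omega)]

lemma hitAll_congr (x n : ℕ) (ω ω' : Ω) (h : ∀ t ≤ n, W t ω = W t ω') (hω : ω ∈ hitAll W x n) :
    ω' ∈ hitAll W x n := by
  unfold hitAll at *
  rw [Set.mem_ofPred_eq] at *
  rwa [← past_congr (n + 1) ω ω' fun t ht => h t (by omega)]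

lemma measurable_hitAll (hmeas : ∀ n, Measurable (W n)) (x n : ℕ) :
    MeasurableSet (hitAll W x n) :=
  measurable_past W hmeas (n + 1) (MeasurableSet.of_discrete
    (s := {l | legsHit x l = Finset.univ}))

lemma step_bound (hK : 1 ≤ K) (hmeas : ∀ n, Measurable (W n))
    (hMarkov : ∀ n (h : ℕ → SpiderV K) (w : SpiderV K),
      P ({ω | W (n + 1) ω = w} ∩ {ω | ∀ k ≤ n, W k ω = h k})
        = spiderKernel K (h n) w * P {ω | ∀ k ≤ n, W k ω = h k})
    (x n N : ℕ) (hx : 1 ≤ x) (D p : ℝ) (hp : 0 ≤ p)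
    (hpf : p ≤ (1 / (K : ℝ)) ^ K * fW N (D + (2 * K - 1) * x)) (T : Set Ω)
    (hT : ∀ ω ω', (∀ t ≤ n, W t ω = W t ω') → ω ∈ T → ω' ∈ T)
    (hD : ∀ ω ∈ T, (ht (W n ω) : ℝ) ≤ D) :
    P.real (T \ hitAll W x (n + N)) ≤ (1 - p) * P.real T := by
  set S := past W (n + 1) '' T with hS
  have hpre : past W (n + 1) ⁻¹' S = T := by
    ext ω
    constructor
    · rintro ⟨ω', h1, h2⟩
      exact hT ω' ω (fun t ht => past_eq_of (n + 1) ω' ω h2 t (by omega)) h1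
    · intro h; exact ⟨ω, h, rfl⟩
  have hSD : ∀ v l, v :: l ∈ S → (ht v : ℝ) ≤ D := by
    rintro v l ⟨ω, h1, h2⟩
    simp only [past, List.cons.injEq] at h2
    rw [← h2.1]; exact hD ω h1
  have h1 := prob_hitAll_ge hK hmeas hMarkov x n N hx D S hSD
  rw [hpre] at h1
  have h2 : p * P.real T ≤ P.real (T ∩ hitAll W x (n + N)) := by
    have h3 := ENNReal.toReal_mono (measure_ne_top _ _) h1
    rw [ENNReal.toReal_mul, ENNReal.toReal_ofReal (hp.trans hpf)] at h3
    exact (mul_le_mul_of_nonneg_right hpf measureReal_nonneg).trans h3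
  have h3 := measureReal_inter_add_sdiff (μ := P) (s := T) (measurable_hitAll hmeas x (n + N))
  linarith

/-- A second Borel-Cantelli argument along the times `nk`. -/
lemma bc_second (hK : 1 ≤ K) (hmeas : ∀ n, Measurable (W n))
    (hMarkov : ∀ n (h : ℕ → SpiderV K) (w : SpiderV K),
      P ({ω | W (n + 1) ω = w} ∩ {ω | ∀ k ≤ n, W k ω = h k})
        = spiderKernel K (h n) w * P {ω | ∀ k ≤ n, W k ω = h k})
    (nk xk : ℕ → ℕ) (D p : ℕ → ℝ) (hmono : Monotone nk)
    (hp : ∀ k, 0 ≤ p k) (hdiv : Tendsto (fun n => ∑ i ∈ Finset.range n, p i) atTop atTop)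
    (hev : ∀ᶠ k in atTop, 1 ≤ xk k ∧
      p k ≤ (1 / (K : ℝ)) ^ K * fW (nk (k + 1) - nk k) (D k + (2 * K - 1) * xk k)) :
    ∀ᵐ ω ∂P, ∃ᶠ k in atTop, ω ∈ hitAll W (xk k) (nk (k + 1)) ∨ D k < ht (W (nk k) ω) := by
  obtain ⟨k0, hk0⟩ := eventually_atTop.mp hev
  have key : ∀ a, k0 ≤ a → P {ω | ∀ i, a ≤ i →
      ¬ (ω ∈ hitAll W (xk i) (nk (i + 1)) ∨ D i < ht (W (nk i) ω))} = 0 := by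
    intro a ha
    set G : ℕ → Set Ω := fun k => {ω | ∀ i, a ≤ i → i < k →
      ¬ (ω ∈ hitAll W (xk i) (nk (i + 1)) ∨ D i < ht (W (nk i) ω))} with hG
    have hGb : ∀ m, P.real (G (a + m)) ≤
        Real.exp (-(∑ i ∈ Finset.range m, p (a + i))) := by
      intro m
      induction m with
      | zero => simp
      | succ m ih =>
        obtain ⟨hx, hpf⟩ := hk0 (a + m) (by omega)
        set T : Set Ω := G (a + m) ∩ {ω | (ht (W (nk (a + m)) ω) : ℝ) ≤ D (a + m)} with hT
        have hle : nk (a + m) ≤ nk (a + m + 1) := hmono (Nat.le_succ _)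
        have h1 := step_bound (P := P) hK hmeas hMarkov (xk (a + m)) (nk (a + m))
          (nk (a + m + 1) - nk (a + m)) hx (D (a + m)) (p (a + m)) (hp _) hpf T ?_ ?_
        · rw [Nat.add_sub_cancel' hle] at h1
          have hsub : G (a + (m + 1)) ⊆ T \ hitAll W (xk (a + m)) (nk (a + m + 1)) := by
            intro ω hω
            have h2 := hω (a + m) (by omega) (by omega)
            rw [not_or, not_lt] at h2
            exact ⟨⟨fun i h3 h4 => hω i h3 (by omega), h2.2⟩, h2.1⟩
          have h5 : P.real T ≤ P.real (G (a + m)) := measureReal_mono Set.inter_subset_left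
          have hT0 : 0 ≤ P.real T := measureReal_nonneg
          calc P.real (G (a + (m + 1))) ≤ (1 - p (a + m)) * P.real T :=
                (measureReal_mono hsub).trans h1
            _ ≤ Real.exp (-p (a + m)) * P.real T := by
                refine mul_le_mul_of_nonneg_right ?_ hT0
                have := Real.add_one_le_exp (-p (a + m)); linarith
            _ ≤ Real.exp (-p (a + m)) * Real.exp (-(∑ i ∈ Finset.range m, p (a + i))) :=
                mul_le_mul_of_nonneg_left (h5.trans ih) (Real.exp_pos _).le
            _ = _ := by
                rw [← Real.exp_add, Finset.sum_range_succ]; ring_nf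
        · rintro ω ω' heq ⟨h2, h3⟩
          refine ⟨fun i hi1 hi2 => ?_, ?_⟩
          · have h4 := h2 i hi1 hi2
            rw [not_or] at h4 ⊢
            have hle2 : nk (i + 1) ≤ nk (a + m) := hmono (by omega)
            have hle3 : nk i ≤ nk (a + m) := hmono (by omega)
            refine ⟨fun h5 => h4.1 (hitAll_congr _ _ ω' ω
              (fun t ht => (heq t (ht.trans hle2)).symm) h5), ?_⟩
            rw [← heq _ hle3]; exact h4.2
          · rw [Set.mem_ofPred_eq] at h3 ⊢
            rw [← heq _ le_rfl]; exact h3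
        · intro ω hω; exact hω.2
    have hlim : Tendsto (fun m => Real.exp (-(∑ i ∈ Finset.range m, p (a + i)))) atTop
        (nhds 0) := by
      apply Real.tendsto_exp_neg_atTop_nhds_zero.comp
      have h1 : Tendsto (fun m => (∑ i ∈ Finset.range (a + m), p i)
          + -(∑ i ∈ Finset.range a, p i)) atTop atTop :=
        tendsto_atTop_add_const_right _ _ (hdiv.comp (tendsto_atTop_mono
          (fun m => Nat.le_add_left m a) tendsto_id))
      refine h1.congr fun m => ?_
      rw [Finset.sum_range_add]; ring
    have hz : P.real {ω | ∀ i, a ≤ i →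
      ¬ (ω ∈ hitAll W (xk i) (nk (i + 1)) ∨ D i < ht (W (nk i) ω))} ≤ 0 := by
      refine ge_of_tendsto' hlim fun m => le_trans ?_ (hGb m)
      exact measureReal_mono fun ω hω i hi _ => hω i hi
    have := le_antisymm hz measureReal_nonneg
    rwa [measureReal_eq_zero_iff] at this
  have hall : ∀ᵐ ω ∂P, ∀ b : ℕ, ¬ (∀ i, k0 + b ≤ i →
      ¬ (ω ∈ hitAll W (xk i) (nk (i + 1)) ∨ D i < ht (W (nk i) ω))) := by
    rw [ae_all_iff]
    intro b
    rw [ae_iff]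
    simpa only [not_not] using key (k0 + b) (by omega)
  filter_upwards [hall] with ω hω
  rw [frequently_atTop]
  intro b
  have := hω b
  push Not at this
  obtain ⟨i, hi, h⟩ := this
  refine ⟨i, by omega, ?_⟩
  tauto

lemma lower_params (b : ℕ) (hb : 9 ≤ b) (l0 A : ℝ) :
    ∀ᶠ k : ℕ in atTop, 1 ≤ k ∧ l0 ≤ Real.log ((k + 1) * Real.log ((b : ℝ) ^ 2 + 1)) ∧
      1 ≤ Real.log ((k + 1) * Real.log ((b : ℝ) ^ 2 + 1)) ∧
      Real.log ((k + 1) * Real.log ((b : ℝ) ^ 2 + 1)) ^ 4 ≤ ((b : ℝ) ^ 2 + 1) ^ k ∧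
      A ≤ Real.sqrt (2 * ((b : ℝ) ^ 2 + 1) ^ k *
        Real.log ((k + 1) * Real.log ((b : ℝ) ^ 2 + 1))) := by
  obtain ⟨c, hc⟩ : ∃ c : ℝ, c = (b : ℝ) ^ 2 + 1 := ⟨_, rfl⟩
  rw [← hc]
  have hb' : (9 : ℝ) ≤ b := by exact_mod_cast hb
  have hc1 : 1 < c := by nlinarith
  have hlc : 0 < Real.log c := Real.log_pos hc1
  have t1 : Tendsto (fun k : ℕ => ((k : ℝ) + 1) * Real.log c) atTop atTop :=
    (tendsto_atTop_add_const_right _ _ tendsto_natCast_atTop_atTop).atTop_mul_const hlc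
  have t2 := Real.tendsto_log_atTop.comp t1
  have t3 : Tendsto (fun k : ℕ => c ^ k) atTop atTop := tendsto_pow_atTop_atTop_of_one_lt hc1
  have t4 := (tendsto_pow_const_div_const_pow_of_one_lt 4 hc1).comp (tendsto_add_atTop_nat 1)
  have hpos : 0 < 1 / (Real.log c ^ 4 * c) := by positivity
  filter_upwards [eventually_ge_atTop 1, t2.eventually_ge_atTop l0, t2.eventually_ge_atTop 1,
    t4.eventually_lt_const hpos, t3.eventually_ge_atTop (A ^ 2)] with k h1 h2 h3 h4 h5
  simp only [Function.comp] at h2 h3 h4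
  refine ⟨h1, h2, h3, ?_, ?_⟩
  · push_cast at h4
    rw [div_lt_div_iff₀ (by positivity) (by positivity), pow_succ c k] at h4
    have h6 : Real.log ((k + 1) * Real.log c) ≤ (k + 1) * Real.log c :=
      Real.log_le_self (by positivity)
    have h7 : Real.log ((k + 1) * Real.log c) ^ 4 ≤ ((k + 1) * Real.log c) ^ 4 :=
      pow_le_pow_left₀ (by linarith) h6 4
    refine h7.trans ?_
    have h8 : ((k + 1) * Real.log c) ^ 4 * c ≤ c ^ k * c := by
      calc ((k + 1) * Real.log c) ^ 4 * c = ((k : ℝ) + 1) ^ 4 * (Real.log c ^ 4 * c) := by ring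
        _ ≤ 1 * (c ^ k * c) := h4.le
        _ = _ := one_mul _
    exact le_of_mul_le_mul_right h8 (by linarith)
  · apply Real.le_sqrt_of_sq_le
    have : 0 < c ^ k := by positivity
    nlinarith

lemma lower_geom (b : ℕ) (ε A x M L lk : ℝ) (hε : 0 < ε) (hε1 : ε < 1) (hbε : 8 ≤ ε * b)
    (hM : 0 < M) (hL : 0 < L) (hlk : lk ≤ L) (hlk0 : 0 ≤ lk) (hA : 0 < A)
    (hAR : A ≤ Real.sqrt (2 * M * L))
    (hx : x ≤ (1 - ε) / A * Real.sqrt (2 * (M * ((b : ℝ) ^ 2 + 1)) * L) + 1) :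
    2 * Real.sqrt (M * lk) + A * x ≤ (1 - ε / 2) * Real.sqrt (2 * (M * (b : ℝ) ^ 2) * L) := by
  have hb : (0 : ℝ) ≤ b := by positivity
  obtain ⟨R, hR⟩ : ∃ R, R = Real.sqrt (2 * M * L) := ⟨_, rfl⟩
  have hR0 : 0 ≤ R := by rw [hR]; exact Real.sqrt_nonneg _
  have e1 : Real.sqrt (2 * (M * (b : ℝ) ^ 2) * L) = R * b := by
    have : 2 * (M * (b : ℝ) ^ 2) * L = 2 * M * L * (b : ℝ) ^ 2 := by ring
    rw [this, Real.sqrt_mul (by positivity), Real.sqrt_sq hb, hR]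
  have e2 : Real.sqrt (2 * (M * ((b : ℝ) ^ 2 + 1)) * L) ≤ R * (b + 1) := by
    have : 2 * (M * ((b : ℝ) ^ 2 + 1)) * L ≤ 2 * M * L * ((b : ℝ) + 1) ^ 2 := by
      have : 0 ≤ 2 * M * L * (2 * b) := by positivity
      linarith
    refine (Real.sqrt_le_sqrt this).trans (le_of_eq ?_)
    rw [Real.sqrt_mul (by positivity), Real.sqrt_sq (by positivity), hR]
  have e3 : Real.sqrt (M * lk) ≤ R := by
    rw [hR]
    apply Real.sqrt_le_sqrt
    have h1 : M * lk ≤ M * L := mul_le_mul_of_nonneg_left hlk hM.le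
    have h2 : 0 < M * L := by positivity
    linarith
  rw [e1]
  rw [← hR] at hAR
  have h3 : A * x ≤ (1 - ε) * (R * (b + 1)) + A := by
    calc A * x ≤ A * ((1 - ε) / A * Real.sqrt (2 * (M * ((b : ℝ) ^ 2 + 1)) * L) + 1) :=
          mul_le_mul_of_nonneg_left hx hA.le
      _ = (1 - ε) * Real.sqrt (2 * (M * ((b : ℝ) ^ 2 + 1)) * L) + A := by field_simp
      _ ≤ _ := by
          have := mul_le_mul_of_nonneg_left e2 (show 0 ≤ 1 - ε by linarith)
          linarith
  have h4 : R * 8 ≤ R * (ε * b) := mul_le_mul_of_nonneg_left hbε hR0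
  have h5 : 0 ≤ R * ε := by positivity
  linarith

lemma lower_bound (hK : 1 ≤ K) (hmeas : ∀ n, Measurable (W n))
    (h0 : ∀ ω, W 0 ω = SpiderV.body)
    (hMarkov : ∀ n (h : ℕ → SpiderV K) (w : SpiderV K),
      P ({ω | W (n + 1) ω = w} ∩ {ω | ∀ k ≤ n, W k ω = h k})
        = spiderKernel K (h n) w * P {ω | ∀ k ≤ n, W k ω = h k})
    (ε : ℝ) (hε : 0 < ε) (hε1 : ε < 1) :
    ∀ᵐ ω ∂P, ∃ᶠ n in atTop, (1 - ε) / (2 * K - 1) * psi n ≤ (mn W n ω : ℝ) := by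
  have hKr : (1 : ℝ) ≤ K := by exact_mod_cast hK
  have hA : (0 : ℝ) < 2 * K - 1 := by linarith
  obtain ⟨b, hb9, hbε⟩ : ∃ b : ℕ, 9 ≤ b ∧ 8 ≤ ε * b := by
    refine ⟨max 9 ⌈8 / ε⌉₊, le_max_left _ _, ?_⟩
    have h1 : 8 / ε ≤ (⌈8 / ε⌉₊ : ℝ) := Nat.le_ceil _
    have h2 : (⌈8 / ε⌉₊ : ℝ) ≤ (max 9 ⌈8 / ε⌉₊ : ℕ) := by exact_mod_cast le_max_right _ _
    have h3 := h1.trans h2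
    rw [div_le_iff₀ hε] at h3
    linarith
  have hb' : (9 : ℝ) ≤ b := by exact_mod_cast hb9
  obtain ⟨l0, hl0, hasymp⟩ := fW_asymp (1 - ε / 2) (by linarith) (by linarith)
  obtain ⟨c, hc⟩ : ∃ c : ℕ, c = b ^ 2 + 1 := ⟨_, rfl⟩
  have hcr : (c : ℝ) = (b : ℝ) ^ 2 + 1 := by rw [hc]; push_cast; rfl
  have hc3 : (3 : ℝ) ≤ c := by rw [hcr]; nlinarith
  have hc2 : 2 ≤ c := by
    have : (2 : ℝ) ≤ c := by linarith
    exact_mod_cast this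
  have hlc : 1 ≤ Real.log c := by
    rw [Real.le_log_iff_exp_le (by linarith)]
    have := Real.exp_one_lt_d9; linarith
  have hparams := lower_params b hb9 l0 (2 * K - 1)
  rw [← hcr] at hparams
  set L : ℕ → ℝ := fun k => Real.log (((k : ℝ) + 1) * Real.log c) with hL
  set D : ℕ → ℝ := fun k => 2 * Real.sqrt ((c : ℝ) ^ k * Real.log k) with hD
  set xk : ℕ → ℕ := fun k => ⌈(1 - ε) / (2 * K - 1) * psi (c ^ (k + 1))⌉₊ with hxk
  set p : ℕ → ℝ := fun k => (1 / (K : ℝ)) ^ K / Real.log c * (1 / ((k : ℝ) + 1)) with hp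
  have hpsi : ∀ k, psi (c ^ (k + 1)) = Real.sqrt (2 * ((c : ℝ) ^ k * c) * L k) := by
    intro k
    unfold psi
    rw [hL]
    push_cast
    rw [Real.log_pow, pow_succ]
    push_cast
    rfl
  have hdiv : Tendsto (fun n => ∑ i ∈ Finset.range n, p i) atTop atTop := by
    simp only [hp, ← Finset.mul_sum]
    exact Real.tendsto_sum_range_one_div_nat_succ_atTop.const_mul_atTop (by positivity)
  have h2 := bc_second (P := P) hK hmeas hMarkov (fun k => c ^ k) xk D p
    (fun i j hij => Nat.pow_le_pow_right (by omega) hij) (fun k => by positivity) hdiv (by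
      filter_upwards [hparams] with k hk
      obtain ⟨hk1, hkl0, hkL1, hk4, hkA⟩ := hk
      have hL0 : 0 < L k := by simp only [hL]; linarith
      have hk1r : (1 : ℝ) ≤ k := by exact_mod_cast hk1
      have hck : (0 : ℝ) < (c : ℝ) ^ k := by positivity
      have hN : ((c ^ (k + 1) - c ^ k : ℕ) : ℝ) = (c : ℝ) ^ k * (b : ℝ) ^ 2 := by
        have : c ^ (k + 1) - c ^ k = c ^ k * b ^ 2 := by
          rw [pow_succ]
          nth_rewrite 2 [hc]
          rw [Nat.mul_add, mul_one, Nat.add_sub_cancel]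
        rw [this]; push_cast; rfl
      have hpsip : 0 < psi (c ^ (k + 1)) := by
        rw [hpsi]; apply Real.sqrt_pos.mpr; positivity
      have h1ε : 0 < 1 - ε := by linarith
      have hxpos : 0 < (1 - ε) / (2 * K - 1) * psi (c ^ (k + 1)) := by positivity
      refine ⟨Nat.ceil_pos.mpr hxpos, ?_⟩
      have hx : (xk k : ℝ) ≤ (1 - ε) / (2 * K - 1) * psi (c ^ (k + 1)) + 1 :=
        (Nat.ceil_lt_add_one hxpos.le).le
      rw [hpsi, hcr, ← hcr] at hx
      have hgeom := lower_geom b ε (2 * K - 1) (xk k) ((c : ℝ) ^ k) (L k) (Real.log k) hε hε1 hbε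
        hck hL0 (Real.log_le_log (by linarith) (by nlinarith)) (Real.log_nonneg hk1r) hA hkA
        (by rw [← hcr]; exact hx)
      have hf := hasymp (L k) hkl0 (c ^ (k + 1) - c ^ k) (by
        rw [hN]
        refine hk4.trans ?_
        nlinarith)
      rw [hN] at hf
      have hf2 := hf.trans (fW_antitone _ hgeom)
      have he : Real.exp (-L k) = 1 / (((k : ℝ) + 1) * Real.log c) := by
        simp only [hL]
        rw [Real.exp_neg, Real.exp_log (by positivity), one_div]
      rw [he] at hf2
      refine le_trans (le_of_eq ?_) (mul_le_mul_of_nonneg_left hf2 (by positivity))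
      simp only [hp]
      field_simp)
  have h1 : ∀ᵐ ω ∂P, ∀ᶠ k in atTop, ω ∉ {ω | D k ≤ ht (W (c ^ k) ω)} := by
    refine bc_first _ (fun k => 2 * (1 / (k : ℝ) ^ 2))
      ((Real.summable_one_div_nat_pow.mpr (by norm_num)).mul_left 2) ?_
    filter_upwards [eventually_ge_atTop 1] with k hk1
    have hk1r : (1 : ℝ) ≤ k := by exact_mod_cast hk1
    have hck : (0 : ℝ) < (c : ℝ) ^ k := by positivity
    have hlk := Real.log_nonneg hk1r
    refine (prob_ht_le hK hmeas h0 hMarkov (c ^ k) (D k) (by positivity)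
      (D k / (c : ℝ) ^ k) (by positivity)).trans ?_
    apply ENNReal.ofReal_le_ofReal
    refine mul_le_mul_of_nonneg_left (le_of_eq ?_) zero_le_two
    have hD2 : D k ^ 2 = 4 * ((c : ℝ) ^ k * Real.log k) := by
      simp only [hD]
      rw [mul_pow, Real.sq_sqrt (by positivity)]; norm_num
    have e : ((c ^ k : ℕ) : ℝ) * (D k / (c : ℝ) ^ k) ^ 2 / 2 - D k / (c : ℝ) ^ k * D k
        = -(2 * Real.log k) := by
      have : ((c ^ k : ℕ) : ℝ) * (D k / (c : ℝ) ^ k) ^ 2 / 2 - D k / (c : ℝ) ^ k * D k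
          = -(D k ^ 2 / (2 * (c : ℝ) ^ k)) := by
        push_cast; field_simp; ring
      rw [this, hD2]; field_simp; ring
    rw [e, Real.exp_neg, show 2 * Real.log k = ((2 : ℕ) : ℝ) * Real.log k by push_cast; rfl,
      Real.exp_nat_mul, Real.exp_log (by linarith), one_div]
  filter_upwards [h1, h2] with ω hω1 hω2
  have h3 : ∃ᶠ k in atTop, (1 - ε) / (2 * K - 1) * psi (c ^ (k + 1)) ≤ (mn W (c ^ (k + 1)) ω : ℝ) := by
    refine (hω2.and_eventually (hω1.and hparams)).mono ?_
    rintro k ⟨ha, hb, hc'⟩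
    rcases ha with ha | ha
    · have hpos : 0 < xk k := by
        obtain ⟨hk1, hkl0, hkL1, hk4, hkA⟩ := hc'
        have hL0 : 0 < L k := by simp only [hL]; linarith
        have hpsip : 0 < psi (c ^ (k + 1)) := by
          rw [hpsi]; apply Real.sqrt_pos.mpr; positivity
        have h1ε : 0 < 1 - ε := by linarith
        exact Nat.ceil_pos.mpr (by positivity)
      rw [mem_hitAll_iff hK _ _ hpos] at ha
      exact (Nat.le_ceil _).trans (Nat.cast_le.mpr ha)
    · exact absurd (le_of_lt ha) hb
  have t : Tendsto (fun k : ℕ => c ^ (k + 1)) atTop atTop :=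
    (tendsto_pow_atTop_atTop_of_one_lt (by omega)).comp (tendsto_add_atTop_nat 1)
  exact t.frequently h3

lemma limsup_aux (u : ℕ → ℝ) (a : ℝ) (ha : 0 < a) (hu0 : ∀ n, 0 ≤ u n)
    (hup : ∀ m : ℕ, ∀ᶠ n in atTop, u n ≤ (1 + 1 / ((m : ℝ) + 1)) ^ 2 * a)
    (hlow : ∀ m : ℕ, ∃ᶠ n in atTop, (1 - 1 / ((m : ℝ) + 2)) * a ≤ u n) :
    limsup u atTop = a := by
  have hbdd : IsBoundedUnder (· ≤ ·) atTop u := ⟨_, eventually_map.mpr (hup 0)⟩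
  have hcob : IsCoboundedUnder (· ≤ ·) atTop u :=
    IsBoundedUnder.isCoboundedUnder_le ⟨0, eventually_map.mpr (Eventually.of_forall hu0)⟩
  apply le_antisymm
  · have t : Tendsto (fun m : ℕ => (1 + 1 / ((m : ℝ) + 1)) ^ 2 * a) atTop (nhds ((1 + 0) ^ 2 * a)) :=
      ((tendsto_const_nhds.add tendsto_one_div_add_atTop_nhds_zero_nat).pow 2).mul_const a
    rw [add_zero, one_pow, one_mul] at t
    exact ge_of_tendsto' t fun m => limsup_le_of_le hcob (hup m)
  · have t0 : Tendsto (fun m : ℕ => 1 / ((m : ℝ) + 2)) atTop (nhds 0) := by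
      refine (tendsto_one_div_add_atTop_nhds_zero_nat.comp (tendsto_add_atTop_nat 1)).congr
        fun m => ?_
      simp only [Function.comp]
      push_cast
      ring_nf
    have t : Tendsto (fun m : ℕ => (1 - 1 / ((m : ℝ) + 2)) * a) atTop (nhds ((1 - 0) * a)) :=
      (tendsto_const_nhds.sub t0).mul_const a
    rw [sub_zero, one_mul] at t
    exact le_of_tendsto' t fun m => le_limsup_of_frequently_le (hlow m) hbdd

lemma psi_pos {n : ℕ} (hn : 3 ≤ n) : 0 < psi n := by
  have hn' : (3 : ℝ) ≤ n := by exact_mod_cast hn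
  have h1 : 1 < Real.log n := by
    rw [Real.lt_log_iff_exp_lt (by linarith)]
    have := Real.exp_one_lt_d9; linarith
  have := Real.log_pos h1
  unfold psi
  apply Real.sqrt_pos.mpr
  positivity

lemma main_aux (hK : 1 ≤ K) (hmeas : ∀ n, Measurable (W n))
    (h0 : ∀ ω, W 0 ω = SpiderV.body)
    (hMarkov : ∀ n (h : ℕ → SpiderV K) (w : SpiderV K),
      P ({ω | W (n + 1) ω = w} ∩ {ω | ∀ k ≤ n, W k ω = h k})
        = spiderKernel K (h n) w * P {ω | ∀ k ≤ n, W k ω = h k}) :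
    ∀ᵐ ω ∂P, limsup (fun n : ℕ => (mn W n ω : ℝ) / psi n) atTop = 1 / (2 * K - 1) := by
  have hKr : (1 : ℝ) ≤ K := by exact_mod_cast hK
  have hA : (0 : ℝ) < 2 * K - 1 := by linarith
  have hU : ∀ᵐ ω ∂P, ∀ m : ℕ, ∀ᶠ n in atTop,
      (mn W n ω : ℝ) ≤ (1 + 1 / ((m : ℝ) + 1)) ^ 2 / (2 * K - 1) * psi n := by
    rw [ae_all_iff]
    intro m
    refine upper_bound hK hmeas h0 hMarkov _ ?_
    have : 0 < 1 / ((m : ℝ) + 1) := by positivity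
    linarith
  have hL : ∀ᵐ ω ∂P, ∀ m : ℕ, ∃ᶠ n in atTop,
      (1 - 1 / ((m : ℝ) + 2)) / (2 * K - 1) * psi n ≤ (mn W n ω : ℝ) := by
    rw [ae_all_iff]
    intro m
    refine lower_bound hK hmeas h0 hMarkov _ (by positivity) ?_
    rw [div_lt_one (by positivity)]
    have : (0 : ℝ) ≤ m := by positivity
    linarith
  filter_upwards [hU, hL] with ω h1 h2
  apply limsup_aux _ _ (by positivity)
  · intro n
    exact div_nonneg (by positivity) (Real.sqrt_nonneg _)
  · intro m
    filter_upwards [h1 m, eventually_ge_atTop 3] with n h3 h4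
    rw [div_le_iff₀ (psi_pos h4), mul_one_div]
    exact h3
  · intro m
    refine ((h2 m).and_eventually (eventually_ge_atTop 3)).mono ?_
    rintro n ⟨h3, h4⟩
    rw [le_div_iff₀ (psi_pos h4), mul_one_div]
    exact h3

end final

end SpiderProof

/-- Theorem 1.6: for the spider `SP(K)` with a fixed number `K` of legs, almost surely
`limsup (min_j M_K(n,j)) / √(2 n log log n) = 1 / (2K - 1)`, where `M_K(n,j)` is the maximal
height reached on leg `j` in the first `n` steps. -/
theorem spider_min_max_height_limsup
    (K : ℕ) (hK : 1 ≤ K)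
    (Ω : Type) [MeasurableSpace Ω] (P : Measure Ω) [IsProbabilityMeasure P]
    (W : ℕ → Ω → SpiderV K)
    (hmeas : ∀ n, Measurable (W n))
    (h0 : ∀ ω, W 0 ω = SpiderV.body)
    (hMarkov : ∀ n (h : ℕ → SpiderV K) (w : SpiderV K),
      P ({ω | W (n + 1) ω = w} ∩ {ω | ∀ k ≤ n, W k ω = h k})
        = spiderKernel K (h n) w * P {ω | ∀ k ≤ n, W k ω = h k}) :
    ∀ᵐ ω ∂P, Filter.limsup (fun n : ℕ =>
        ((sInf (Set.range fun j : Fin K =>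
            (Finset.range (n + 1)).sup fun t => heightOnLeg j (W t ω)) : ℕ) : ℝ)
          / Real.sqrt (2 * n * Real.log (Real.log n))) atTop
      = 1 / (2 * K - 1) := by
  exact SpiderProof.main_aux hK hmeas h0 hMarkov
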